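/- There exists a constant ν > 0 with the following property: for every triangle Δ = pqr in Γ(G, X ∪ 𝓗) whose sides p, q, r are geodesics, and for every vertex v on p, there exists a vertex u on the union q ∪ r such that dist_X(u, v) ≤ ν. -/

import Mathlib

namespace RelHyp

variable {G : Type*} [Group G] {Λ : Type*}

/-- Length of a shortest word over the alphabet `S ∪ S⁻¹` representing `g`. -/
noncomputable def wordLength (S : Set G) (g : G) : ℕ :=
  sInf {n | ∃ w : List G, w.length = n ∧ (∀ x ∈ w, x ∈ S ∨ x⁻¹ ∈ S) ∧ w.prod = g}

/-- The free product `F = (∗_λ H_λ) ∗ F(X)`. -/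
abbrev RelFree (H : Λ → Subgroup G) (X : Set G) : Type _ :=
  Monoid.Coprod (Monoid.CoprodI fun l => ↥(H l)) (FreeGroup ↥X)

/-- The canonical homomorphism `ε : F → G`. -/
def relEps (H : Λ → Subgroup G) (X : Set G) : RelFree H X →* G :=
  Monoid.Coprod.lift (Monoid.CoprodI.lift fun l => (H l).subtype)
    (FreeGroup.lift fun x => (x : G))

/-- Letters of the alphabet `X ∪ 𝓗`, where `𝓗 = ⊔_λ (H̃_λ ∖ {1})`. -/
abbrev RelLetter (H : Λ → Subgroup G) (X : Set G) : Type _ :=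
  (Σ l : Λ, {h : ↥(H l) // h ≠ 1}) ⊕ (↥X × Bool)

/-- The image of a letter in the free product `F`. -/
def RelLetter.toF {H : Λ → Subgroup G} {X : Set G} : RelLetter H X → RelFree H X
  | Sum.inl ⟨_, h⟩ => Monoid.Coprod.inl (Monoid.CoprodI.of h.1)
  | Sum.inr (x, b) => Monoid.Coprod.inr (if b then FreeGroup.of x else (FreeGroup.of x)⁻¹)

/-- The element of `G` represented by a letter. -/
def RelLetter.val {H : Λ → Subgroup G} {X : Set G} : RelLetter H X → G
  | Sum.inl ⟨_, h⟩ => (h.1 : G)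
  | Sum.inr (x, b) => if b then (x : G) else (x : G)⁻¹

/-- The index `λ` such that the letter belongs to `H̃_λ`, if any. -/
def RelLetter.hIndex {H : Λ → Subgroup G} {X : Set G} : RelLetter H X → Option Λ
  | Sum.inl ⟨l, _⟩ => some l
  | Sum.inr _ => none

/-- The element of `F` represented by a word over `X ∪ 𝓗`. -/
def wordToF {H : Λ → Subgroup G} {X : Set G} (w : List (RelLetter H X)) : RelFree H X :=
  (w.map RelLetter.toF).prod

/-- `f` is a relative isoperimetric function of the relative presentation `⟨X, H | R⟩`. -/
def IsIsoperFn (H : Λ → Subgroup G) (X : Set G) (R : Set (RelFree H X)) (f : ℕ → ℕ) : Prop :=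
  ∀ w : List (RelLetter H X), relEps H X (wordToF w) = 1 →
    ∃ k ≤ f w.length, ∃ r c : Fin k → RelFree H X,
      (∀ i, r i ∈ R) ∧ wordToF w = (List.ofFn fun i => (c i)⁻¹ * r i * c i).prod

/-- `⟨X, H | R⟩` is a finite relative presentation of `G` w.r.t. the collection `H`. -/
structure IsFiniteRelPres (H : Λ → Subgroup G) (X : Set G) (R : Set (RelFree H X)) : Prop where
  finX : X.Finite
  finR : R.Finite
  surj : Function.Surjective (relEps H X)
  ker : (relEps H X).ker = Subgroup.normalClosure R

/-- `G` is finitely presented relative to the collection of subgroups `H`. -/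
def FinitelyPresentedRel (H : Λ → Subgroup G) : Prop :=
  ∃ (X : Set G) (R : Set (RelFree H X)), IsFiniteRelPres H X R

/-- The relative area of a word representing `1`. -/
noncomputable def relArea (H : Λ → Subgroup G) (X : Set G) (R : Set (RelFree H X))
    (w : List (RelLetter H X)) : ℕ :=
  sInf {k | ∃ r c : Fin k → RelFree H X,
    (∀ i, r i ∈ R) ∧ wordToF w = (List.ofFn fun i => (c i)⁻¹ * r i * c i).prod}

/-- The relative Dehn function of the presentation `⟨X, H | R⟩`. -/
noncomputable def relDehn (H : Λ → Subgroup G) (X : Set G) (R : Set (RelFree H X))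
    (n : ℕ) : ℕ :=
  sSup {a | ∃ w : List (RelLetter H X), w.length ≤ n ∧ relEps H X (wordToF w) = 1 ∧
    a = relArea H X R w}

/-- The relative Dehn function is well-defined (finite for each value of the argument),
i.e. there exists a finite-valued relative isoperimetric function. -/
def DehnWellDefined (H : Λ → Subgroup G) (X : Set G) (R : Set (RelFree H X)) : Prop :=
  ∃ f : ℕ → ℕ, IsIsoperFn H X R f

/-- `f ⪯ g`. -/
def AsympLE (f g : ℕ → ℕ) : Prop := ∃ C K L : ℕ, ∀ n, f n ≤ C * g (K * n) + L * n

/-- `f ∼ g`. -/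
def AsympEquiv (f g : ℕ → ℕ) : Prop := AsympLE f g ∧ AsympLE g f

/-- `G` is hyperbolic relative to `H`: it admits a finite relative presentation with a
linear relative isoperimetric function. -/
def IsRelHyperbolic (H : Λ → Subgroup G) : Prop :=
  ∃ (X : Set G) (R : Set (RelFree H X)), IsFiniteRelPres H X R ∧
    ∃ A B : ℕ, IsIsoperFn H X R fun n => A * n + B

/-- The subnegative closure of `f`. -/
noncomputable def subnegClosure (f : ℕ → ℕ) (n : ℕ) : ℕ :=
  sSup {s | ∃ L : List ℕ, (∀ a ∈ L, 0 < a) ∧ L.sum = n ∧ s = (L.map f).sum}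

/-- A combinatorial path in the Cayley graph `Γ(G, X ∪ 𝓗)`: a starting vertex
together with the word labelling the path. -/
structure RelPath (H : Λ → Subgroup G) (X : Set G) where
  start : G
  word : List (RelLetter H X)

namespace RelPath

variable {H : Λ → Subgroup G} {X : Set G}

/-- The length of the path. -/
def len (p : RelPath H X) : ℕ := p.word.length

/-- The `k`-th vertex of the path. -/
def vertex (p : RelPath H X) (k : ℕ) : G :=
  p.start * ((p.word.take k).map RelLetter.val).prod

/-- The terminal vertex of the path. -/
def finish (p : RelPath H X) : G := p.vertex p.word.length

end RelPath

/-- The combinatorial metric `dist_{X ∪ 𝓗}` on `G`. -/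
noncomputable def relDist (H : Λ → Subgroup G) (X : Set G) (g h : G) : ℕ :=
  wordLength (X ∪ ⋃ l, (H l : Set G)) (g⁻¹ * h)

/-- The relative length `|g|_{X ∪ 𝓗}`. -/
noncomputable def relLen (H : Λ → Subgroup G) (X : Set G) (g : G) : ℕ :=
  wordLength (X ∪ ⋃ l, (H l : Set G)) g

/-- The word metric `dist_X` on `G`. -/
noncomputable def xDist (X : Set G) (g h : G) : ℕ := wordLength X (g⁻¹ * h)

variable {H : Λ → Subgroup G} {X : Set G}

/-- `p` is a `(λ, c)`-quasi-geodesic in `Γ(G, X ∪ 𝓗)`. -/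
def IsQuasiGeodesic (lam c : ℝ) (p : RelPath H X) : Prop :=
  ∀ i j : ℕ, i ≤ j → j ≤ p.len →
    ((j - i : ℕ) : ℝ) ≤ lam * (relDist H X (p.vertex i) (p.vertex j) : ℝ) + c

/-- `p` is a geodesic in `Γ(G, X ∪ 𝓗)`. -/
def IsGeodesic (p : RelPath H X) : Prop :=
  ∀ i j : ℕ, i ≤ j → j ≤ p.len → j - i = relDist H X (p.vertex i) (p.vertex j)

/-- The `k`-th letter of `p` is a letter of `H̃_l`. -/
def LetterIsH (p : RelPath H X) (l : Λ) (k : ℕ) : Prop :=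
  ∃ a, p.word[k]? = some a ∧ a.hIndex = some l

/-- The subpath of `p` consisting of the letters with indices `a, …, b` is an
`H_l`-component of `p` (a maximal nonempty `H_l`-subword). -/
def IsComponent (p : RelPath H X) (l : Λ) (a b : ℕ) : Prop :=
  a ≤ b ∧ b < p.len ∧ (∀ k, a ≤ k → k ≤ b → LetterIsH p l k) ∧
    (a = 0 ∨ ¬ LetterIsH p l (a - 1)) ∧ (b + 1 = p.len ∨ ¬ LetterIsH p l (b + 1))

/-- The `H_l`-components of `p` starting at index `a` and of `q` starting at `a'`
are connected (their vertices lie in the same left coset of `H_l`). -/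
def ConnectedComp (p q : RelPath H X) (l : Λ) (a a' : ℕ) : Prop :=
  (p.vertex a)⁻¹ * q.vertex a' ∈ H l

/-- `p` is a path without backtracking: all of its components are isolated. -/
def NoBacktracking (p : RelPath H X) : Prop :=
  ∀ l a b a' b', IsComponent p l a b → IsComponent p l a' b' →
    ConnectedComp p p l a a' → a = a' ∧ b = b'

/-- The `k`-th vertex of `p` is a phase vertex (not an inner vertex of a component). -/
def IsPhase (p : RelPath H X) (k : ℕ) : Prop :=
  ¬ ∃ l a b, IsComponent p l a b ∧ a < k ∧ k ≤ b

/-- `p` and `q` are `k`-similar: their endpoints are `X`-distance at most `k` apart. -/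
def Similar (k : ℝ) (p q : RelPath H X) : Prop :=
  (xDist X p.start q.start : ℝ) ≤ k ∧ (xDist X p.finish q.finish : ℝ) ≤ k

/-- The Rips thin-triangles condition for `Γ(G, X ∪ 𝓗)` with constant `δ`. -/
def RipsThin (H : Λ → Subgroup G) (X : Set G) (δ : ℝ) : Prop :=
  ∀ p q r : RelPath H X, IsGeodesic p → IsGeodesic q → IsGeodesic r →
    p.finish = q.start → q.finish = r.start → r.finish = p.start →
    ∀ i ≤ p.len, ∃ j : ℕ,
      (j ≤ q.len ∧ (relDist H X (p.vertex i) (q.vertex j) : ℝ) ≤ δ) ∨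
      (j ≤ r.len ∧ (relDist H X (p.vertex i) (r.vertex j) : ℝ) ≤ δ)

/-- The Cayley graph `Γ(G, X ∪ 𝓗)` is a hyperbolic metric space. -/
def CayleyHyperbolic (H : Λ → Subgroup G) (X : Set G) : Prop :=
  ∃ δ : ℝ, 0 ≤ δ ∧ RipsThin H X δ

/-- `R` is a relatively quasi-convex subgroup of `G`. -/
def RelQuasiconvex (H : Λ → Subgroup G) (X : Set G) (R : Subgroup G) : Prop :=
  ∃ σ : ℝ, 0 < σ ∧ ∀ p : RelPath H X, IsGeodesic p → p.start ∈ R → p.finish ∈ R →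
    ∀ k ≤ p.len, ∃ w ∈ R, (xDist X (p.vertex k) w : ℝ) ≤ σ

/-- `R` is a strongly relatively quasi-convex subgroup of `G`. -/
def StronglyRelQuasiconvex (H : Λ → Subgroup G) (X : Set G) (R : Subgroup G) : Prop :=
  RelQuasiconvex H X R ∧ ∀ (g : G) (l : Λ), {x : G | x ∈ R ∧ g * x * g⁻¹ ∈ H l}.Finite

/-- `g` is a hyperbolic element: it is not conjugate to an element of any `H_λ`. -/
def IsHypElt (H : Λ → Subgroup G) (g : G) : Prop :=
  ∀ l : Λ, ∀ x ∈ H l, ¬ IsConj g x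

end RelHyp

open RelHyp

namespace RelHyp

section Geometry

variable {V : Type*}

/-- A symmetric `ℕ`-valued pseudometric. -/
structure IsPseudoDist (d : V → V → ℕ) : Prop where
  self : ∀ a, d a a = 0
  symm : ∀ a b, d a b = d b a
  tri : ∀ a b c, d a c ≤ d a b + d b c

/-- `γ` restricted to `0, …, n` is a geodesic for `d`. -/
def IsGeo (d : V → V → ℕ) (γ : ℕ → V) (n : ℕ) : Prop :=
  ∀ i j, i ≤ j → j ≤ n → d (γ i) (γ j) = j - i

/-- Any two points are joined by a geodesic. -/
def HasGeo (d : V → V → ℕ) : Prop :=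
  ∀ a b, ∃ γ : ℕ → V, γ 0 = a ∧ γ (d a b) = b ∧ IsGeo d γ (d a b)

/-- `f` is `1`-Lipschitz with respect to `d`. -/
def Lip (d : V → V → ℕ) (f : V → ℤ) : Prop :=
  ∀ a b, f b ≤ f a + d a b

/-- A discrete version of the `1`-form `ρ dβ`, where `m` is a local base value for `β`. -/
def edgeForm (ρ β : V → ℤ) (m : V → V → ℤ) (a b : V) : ℤ :=
  ρ b * (β b - m a b) - ρ a * (β a - m a b)

/-- `m a b` is a lower bound for `β a` and `β b` attained at a common neighbour of `a` and `b`. -/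
def IsBaseValue (d : V → V → ℕ) (β : V → ℤ) (m : V → V → ℤ) : Prop :=
  ∀ a b, d a b ≤ 1 → m a b ≤ β a ∧ m a b ≤ β b ∧ ∃ c, d c a ≤ 1 ∧ d c b ≤ 1 ∧ β c = m a b

/-- There is a path from `a` to `b` of length at most `n` along which `φ` sums to at least `S`. -/
inductive Reach (d : V → V → ℕ) (φ : V → V → ℤ) (a : V) : V → ℕ → ℤ → Prop
  | refl (n : ℕ) (S : ℤ) (hS : S ≤ 0) : Reach d φ a a n S
  | step {b c : V} {n : ℕ} {S S' : ℤ} (h : Reach d φ a b n S) (hbc : d b c ≤ 1)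
      (hS : S' ≤ S + φ b c) : Reach d φ a c (n + 1) S'

/-- There is a path from `a` to `b` of length at most `n`, all but at most `e` of whose edges
satisfy `E`. -/
inductive EPath (d : V → V → ℕ) (E : V → V → Prop) (a : V) : V → ℕ → ℕ → Prop
  | refl (n e : ℕ) : EPath d E a a n e
  | step {b c : V} {n e : ℕ} (h : EPath d E a b n e) (hbc : d b c ≤ 1) (hE : E b c) :
      EPath d E a c (n + 1) e
  | jump {b c : V} {n e : ℕ} (h : EPath d E a b n e) (hbc : d b c ≤ 1) :
      EPath d E a c (n + 1) (e + 1)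

/-- Linear filling inequality: the integral of `ρ dβ` over a loop is at most linear in its
length, for all `dX`-Lipschitz `ρ` and `d`-Lipschitz `β`. -/
def LinFill (d dX : V → V → ℕ) (C : ℕ) : Prop :=
  ∀ ρ β : V → ℤ, Lip dX ρ → Lip d β → ∃ m, IsBaseValue d β m ∧
    ∀ a n S, Reach d (edgeForm ρ β m) a a n S → S ≤ C * n

variable {d dX : V → V → ℕ} {φ : V → V → ℤ} {E : V → V → Prop}

theorem Reach.mono {a b : V} {n n' : ℕ} {S S' : ℤ} (h : Reach d φ a b n S) (hn : n ≤ n')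
    (hS : S' ≤ S) : Reach d φ a b n' S' := by
  induction h generalizing n' S' with
  | refl n S h0 => exact .refl _ _ (hS.trans h0)
  | step h hbc h' ih =>
    obtain ⟨k, rfl⟩ : ∃ k, n' = k + 1 := ⟨n' - 1, by omega⟩
    exact .step (ih (by omega) le_rfl) hbc (hS.trans h')

theorem Reach.trans {a b c : V} {n n' : ℕ} {S S' : ℤ} (h : Reach d φ a b n S)
    (h' : Reach d φ b c n' S') : Reach d φ a c (n + n') (S + S') := by
  induction h' with
  | refl n' S' h0 => exact h.mono (by omega) (by omega)
  | step _ hbc hS ih => exact .step ih hbc (by omega)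

theorem EPath.mono {a b : V} {n n' e e' : ℕ} (h : EPath d E a b n e) (hn : n ≤ n')
    (he : e ≤ e') : EPath d E a b n' e' := by
  induction h generalizing n' e' with
  | refl => exact .refl _ _
  | step h hbc hE ih =>
    obtain ⟨k, rfl⟩ : ∃ k, n' = k + 1 := ⟨n' - 1, by omega⟩
    exact .step (ih (by omega) he) hbc hE
  | jump h hbc ih =>
    obtain ⟨k, rfl⟩ : ∃ k, n' = k + 1 := ⟨n' - 1, by omega⟩
    obtain ⟨j, rfl⟩ : ∃ j, e' = j + 1 := ⟨e' - 1, by omega⟩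
    exact .jump (ih (by omega) (by omega)) hbc

theorem EPath.trans {a b c : V} {n n' e e' : ℕ} (h : EPath d E a b n e)
    (h' : EPath d E b c n' e') : EPath d E a c (n + n') (e + e') := by
  induction h' with
  | refl n' e' => exact h.mono (by omega) (by omega)
  | step _ hbc hE ih => exact .step ih hbc hE
  | jump _ hbc ih => exact .jump ih hbc

theorem EPath.symm (hd : IsPseudoDist d) (hE : ∀ a b, E a b → E b a) {a b : V} {n e : ℕ}
    (h : EPath d E a b n e) : EPath d E b a n e := by
  induction h with
  | refl => exact .refl _ _
  | step _ hbc h1 ih =>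
    have := (EPath.step (.refl 0 0) (hd.symm _ _ ▸ hbc) (hE _ _ h1)).trans ih
    exact this.mono (by omega) (by omega)
  | jump _ hbc ih =>
    have := (EPath.jump (E := E) (.refl 0 0) (hd.symm _ _ ▸ hbc)).trans ih
    exact this.mono (by omega) (by omega)

theorem EPath.reach {k : ℕ} (hE : ∀ a b, d a b ≤ 1 → E a b → 0 ≤ φ a b)
    (hk : ∀ a b, d a b ≤ 1 → -(k : ℤ) ≤ φ a b) {a b : V} {n e : ℕ} (h : EPath d E a b n e) :
    Reach d φ a b n (-(k * e : ℤ)) := by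
  induction h with
  | refl n e => exact .refl _ _ (by simp only [Left.neg_nonpos_iff]; positivity)
  | step _ hbc h1 ih => exact .step ih hbc (by linarith [hE _ _ hbc h1])
  | jump _ hbc ih => exact .step ih hbc (by push_cast; linarith [hk _ _ hbc])

theorem reach_of_seq {γ : ℕ → V} {c : ℕ → ℤ} (n : ℕ) (h1 : ∀ t < n, d (γ t) (γ (t + 1)) ≤ 1)
    (h2 : ∀ t < n, c t ≤ φ (γ t) (γ (t + 1))) :
    Reach d φ (γ 0) (γ n) n (∑ t ∈ Finset.range n, c t) := by
  induction n with
  | zero => exact .refl _ _ (by simp)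
  | succ n ih =>
    refine .step (ih (fun t ht => h1 t (by omega)) fun t ht => h2 t (by omega)) (h1 n (by omega)) ?_
    rw [Finset.sum_range_succ]
    linarith [h2 n (by omega)]

theorem IsGeo.step {γ : ℕ → V} {n t : ℕ} (h : IsGeo d γ n) (ht : t < n) :
    d (γ t) (γ (t + 1)) ≤ 1 := by
  rw [h t (t + 1) (by omega) (by omega)]; omega

theorem IsGeo.epath {γ : ℕ → V} {n : ℕ} (h : IsGeo d γ n)
    (hE : ∀ t < n, E (γ t) (γ (t + 1))) : EPath d E (γ 0) (γ n) n 0 := by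
  induction n with
  | zero => exact .refl _ _
  | succ n ih =>
    exact .step (ih (fun i j hij hj => h i j hij (by omega)) fun t ht => hE t (by omega))
      (h.step (by omega)) (hE n (by omega))

theorem IsGeo.epath_jump {γ : ℕ → V} {n : ℕ} (h : IsGeo d γ n) :
    EPath d E (γ 0) (γ n) n n := by
  induction n with
  | zero => exact .refl _ _
  | succ n ih =>
    exact .jump (ih (fun i j hij hj => h i j hij (by omega))) (h.step (by omega))

theorem epath_of_dist_le (hg : HasGeo d) {a b : V} {n : ℕ} (h : d a b ≤ n) :
    EPath d E a b n n := by
  obtain ⟨γ, h0, h1, hγ⟩ := hg a b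
  have := hγ.epath_jump (E := E)
  rw [h0, h1] at this
  exact this.mono h h

theorem IsGeo.sub {γ : ℕ → V} {n i ℓ : ℕ} (h : IsGeo d γ n) (hi : i + ℓ ≤ n) :
    IsGeo d (fun t => γ (i + t)) ℓ := fun a b hab hb => by
  rw [h (i + a) (i + b) (by omega) (by omega)]; omega

/-- The subsegment of a geodesic between two of its vertices, in either direction. -/
theorem IsGeo.seg (hd : IsPseudoDist d) {γ : ℕ → V} {n i j : ℕ} (h : IsGeo d γ n)
    (hi : i ≤ n) (hj : j ≤ n) :
    ∃ g : ℕ → V, IsGeo d g (d (γ i) (γ j)) ∧ g 0 = γ i ∧ g (d (γ i) (γ j)) = γ j ∧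
      ∀ t ≤ d (γ i) (γ j), ∃ u ≤ n, g t = γ u := by
  rcases le_total i j with hij | hij
  · rw [h i j hij hj]
    exact ⟨fun t => γ (i + t), h.sub (by omega), by simp, by simp [Nat.add_sub_cancel' hij],
      fun t ht => ⟨i + t, by omega, rfl⟩⟩
  · rw [hd.symm, h j i hij hi]
    refine ⟨fun t => γ (i - t), ?_, by simp, by simp [Nat.sub_sub_self hij],
      fun t ht => ⟨i - t, by omega, rfl⟩⟩
    intro a b hab hb
    rw [hd.symm, h (i - b) (i - a) (by omega) (by omega)]; omega

theorem edgeForm_ge {ρ β : V → ℤ} {m : V → V → ℤ} {k : ℕ} (hβ : Lip d β)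
    (hm : IsBaseValue d β m) (h0 : ∀ a, 0 ≤ ρ a) (hk : ∀ a, ρ a ≤ k) {a b : V} (hab : d a b ≤ 1) :
    -(k : ℤ) ≤ edgeForm ρ β m a b := by
  obtain ⟨h1, h2, c, hc, -, hcm⟩ := hm a b hab
  have h3 := hβ c a
  have h4 : (d c a : ℤ) ≤ 1 := by exact_mod_cast hc
  have h5 : 0 ≤ ρ b * (β b - m a b) := mul_nonneg (h0 b) (by omega)
  have h6 : ρ a * (β a - m a b) ≤ k * 1 :=
    mul_le_mul (hk a) (by omega) (by omega) (by positivity)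
  unfold edgeForm
  omega

/-- If a geodesic of length `ℓ` stays at distance at least `k` from `Q` and is closed up by a path
of length `n` all but `e` of whose edges lie in `Q`, then `k ℓ ≤ C (ℓ + n) + k e`. -/
theorem LinFill.width_bound {C : ℕ} (hF : LinFill d dX C) (hd : IsPseudoDist d)
    (hle : ∀ a b, d a b ≤ dX a b) (Q : Set V) (k : ℕ) {γ : ℕ → V} {ℓ : ℕ} (hγ : IsGeo d γ ℓ)
    (hfar : ∀ t ≤ ℓ, ∀ u ∈ Q, k ≤ d (γ t) u) {n e : ℕ}
    (hp : EPath d (fun a b => a ∈ Q ∧ b ∈ Q) (γ ℓ) (γ 0) n e) :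
    k * ℓ ≤ C * (ℓ + n) + k * e := by
  have hne : (Finset.range (ℓ + 1)).Nonempty := ⟨0, by simp⟩
  set D : V → ℕ := fun a => (Finset.range (ℓ + 1)).inf' hne fun t => d a (γ t) with hD
  have hDle : ∀ a, ∀ t ≤ ℓ, D a ≤ d a (γ t) := fun a t ht =>
    Finset.inf'_le _ (by simp; omega)
  have hDex : ∀ a, ∃ t ≤ ℓ, D a = d a (γ t) := fun a => by
    obtain ⟨t, ht, h⟩ := Finset.exists_mem_eq_inf' hne fun t => d a (γ t)
    exact ⟨t, by simp at ht; omega, h⟩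
  have hDlip : ∀ a b, D a ≤ D b + d a b := fun a b => by
    obtain ⟨t, ht, h⟩ := hDex b
    have := hDle a t ht
    have := hd.tri a b (γ t)
    omega
  obtain ⟨m, hm, hmain⟩ := hF (fun a => ((k - D a : ℕ) : ℤ)) (fun a => (d (γ 0) a : ℤ))
    (fun a b => by
      have h1 := hDlip a b
      have h2 := hle a b
      dsimp only
      omega)
    (fun a b => by dsimp only; exact_mod_cast hd.tri (γ 0) a b)
  have hβ : Lip d (fun a => (d (γ 0) a : ℤ)) :=
    fun a b => by dsimp only; exact_mod_cast hd.tri (γ 0) a b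
  have r1 : Reach d (edgeForm (fun a => ((k - D a : ℕ) : ℤ)) (fun a => (d (γ 0) a : ℤ)) m)
      (γ 0) (γ ℓ) ℓ (∑ t ∈ Finset.range ℓ, (k : ℤ)) := by
    refine reach_of_seq ℓ (fun t ht => hγ.step ht) fun t ht => ?_
    have e1 : D (γ t) = 0 := by have := hDle (γ t) t (by omega); rw [hd.self] at this; omega
    have e2 : D (γ (t + 1)) = 0 := by
      have := hDle (γ (t + 1)) (t + 1) (by omega); rw [hd.self] at this; omega
    simp only [edgeForm, e1, e2, hγ 0 t (by omega) (by omega),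
      hγ 0 (t + 1) (by omega) (by omega)]
    push_cast
    simp only [Nat.sub_zero]
    apply le_of_eq; ring
  have r2 := hp.reach (k := k)
    (φ := edgeForm (fun a => ((k - D a : ℕ) : ℤ)) (fun a => (d (γ 0) a : ℤ)) m)
    (fun a b _ hE => by
      have hz : ∀ u ∈ Q, k - D u = 0 := fun u hu => by
        obtain ⟨t, ht, h⟩ := hDex u
        have := hfar t ht u hu
        rw [hd.symm] at this
        omega
      simp [edgeForm, hz a hE.1, hz b hE.2])
    (fun a b hab => edgeForm_ge hβ hm (fun a => by positivity) (fun a => by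
      exact_mod_cast Nat.sub_le _ _) hab)
  have := hmain _ _ _ (r1.trans r2)
  simp only [Finset.sum_const, Finset.card_range, nsmul_eq_mul] at this
  zify
  push_cast at this
  linarith

/-- The width bound for a geodesic closed up by two further geodesics and three short
connecting paths. -/
theorem LinFill.hexagon {C : ℕ} (hF : LinFill d dX C) (hd : IsPseudoDist d)
    (hle : ∀ a b, d a b ≤ dX a b) (hg : HasGeo d) (k κ : ℕ) {γ₁ γ₂ γ₃ : ℕ → V} {ℓ₁ ℓ₂ ℓ₃ : ℕ}
    (h₁ : IsGeo d γ₁ ℓ₁) (h₂ : IsGeo d γ₂ ℓ₂) (h₃ : IsGeo d γ₃ ℓ₃)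
    (h₁₂ : d (γ₁ ℓ₁) (γ₂ 0) ≤ κ) (h₂₃ : d (γ₂ ℓ₂) (γ₃ 0) ≤ κ) (h₃₁ : d (γ₃ ℓ₃) (γ₁ 0) ≤ κ)
    (hf₂ : ∀ t ≤ ℓ₁, ∀ u ≤ ℓ₂, k ≤ d (γ₁ t) (γ₂ u))
    (hf₃ : ∀ t ≤ ℓ₁, ∀ u ≤ ℓ₃, k ≤ d (γ₁ t) (γ₃ u)) :
    k * ℓ₁ ≤ C * (ℓ₁ + ℓ₂ + ℓ₃ + 3 * κ) + k * (3 * κ) := by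
  have key := hF.width_bound hd hle {u | (∃ t ≤ ℓ₂, u = γ₂ t) ∨ ∃ t ≤ ℓ₃, u = γ₃ t} k h₁
    (n := κ + ℓ₂ + κ + ℓ₃ + κ) (e := κ + 0 + κ + 0 + κ)
    (by
      rintro t ht u (⟨v, hv, rfl⟩ | ⟨v, hv, rfl⟩)
      · exact hf₂ t ht v hv
      · exact hf₃ t ht v hv)
    (((((epath_of_dist_le hg h₁₂).trans (h₂.epath fun t ht =>
      ⟨.inl ⟨t, by omega, rfl⟩, .inl ⟨t + 1, by omega, rfl⟩⟩)).trans
      (epath_of_dist_le hg h₂₃)).trans (h₃.epath fun t ht =>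
      ⟨.inr ⟨t, by omega, rfl⟩, .inr ⟨t + 1, by omega, rfl⟩⟩)).trans
      (epath_of_dist_le hg h₃₁))
  linarith

/-- A geodesic whose endpoints are close to another geodesic stays close to it. -/
theorem LinFill.near_of_near_ends {C : ℕ} (hF : LinFill d dX C) (hd : IsPseudoDist d)
    (hle : ∀ a b, d a b ≤ dX a b) (hg : HasGeo d) :
    ∃ M, 3 * C + 1 ≤ M ∧ ∀ (p r : ℕ → V) (a c : ℕ), IsGeo d p a → IsGeo d r c →
      ∀ i s i', i ≤ s → s ≤ i' → i' ≤ a → (∃ j ≤ c, d (p i) (r j) ≤ 3 * C + 1) →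
        (∃ j ≤ c, d (p i') (r j) ≤ 3 * C + 1) → ∃ j ≤ c, d (p s) (r j) ≤ M := by
  classical
  set k := 3 * C + 1 with hk
  refine ⟨C * (5 * k) + k * (3 * k) + k, by omega, fun p r a c hp hr i s i' his hsi hia hi hi' => ?_⟩
  by_cases hs : ∃ j ≤ c, d (p s) (r j) ≤ k
  · obtain ⟨j, hj, h⟩ := hs
    exact ⟨j, hj, h.trans (by omega)⟩
  let P : ℕ → Prop := fun t => ∃ j ≤ c, d (p t) (r j) ≤ k
  obtain ⟨i₀, h0s, hP0, hmax⟩ : ∃ i₀ ≤ s, P i₀ ∧ ∀ t, i₀ < t → t ≤ s → ¬ P t := by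
    refine ⟨Nat.findGreatest P s, Nat.findGreatest_le s, Nat.findGreatest_spec his hi, ?_⟩
    exact fun t h1 h2 => Nat.findGreatest_is_greatest h1 h2
  have hex : ∃ t, s ≤ t ∧ P t := ⟨i', hsi, hi'⟩
  obtain ⟨h1s, hP1⟩ := Nat.find_spec hex
  have hmin : ∀ t, s ≤ t → t < Nat.find hex → ¬ P t := fun t h1 h2 hP =>
    Nat.find_min hex h2 ⟨h1, hP⟩
  have h1a : Nat.find hex ≤ a := (Nat.find_min' hex ⟨hsi, hi'⟩).trans hia
  generalize Nat.find hex = i₁ at *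
  have hs0 : i₀ ≠ s := fun h => hs (h ▸ hP0)
  have hs1 : i₁ ≠ s := fun h => hs (h ▸ hP1)
  have hbetween : ∀ t, i₀ < t → t < i₁ → ∀ j ≤ c, k < d (p t) (r j) := by
    intro t h1 h2 j hj
    by_contra hc
    rcases le_total t s with h | h
    · exact hmax t h1 h ⟨j, hj, by omega⟩
    · exact hmin t h h2 ⟨j, hj, by omega⟩
  have hfar : ∀ t, i₀ ≤ t → t ≤ i₁ → ∀ j ≤ c, k ≤ d (p t) (r j) := by
    intro t h1 h2 j hj
    rcases h1.eq_or_lt with h | h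
    · have e1 := hbetween (t + 1) (by omega) (by omega) j hj
      have e2 := hp.step (t := t) (by omega)
      have e3 := hd.tri (p (t + 1)) (p t) (r j)
      rw [hd.symm (p (t + 1)) (p t)] at e3
      omega
    · rcases h2.eq_or_lt with h' | h'
      · obtain ⟨t, rfl⟩ : ∃ u, t = u + 1 := ⟨t - 1, by omega⟩
        have e1 := hbetween t (by omega) (by omega) j hj
        have e2 := hp.step (t := t) (by omega)
        have e3 := hd.tri (p t) (p (t + 1)) (r j)
        omega
      · exact (hbetween t h h' j hj).le
  obtain ⟨j₀, hj0, hd0⟩ := hP0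
  obtain ⟨j₁, hj1, hd1⟩ := hP1
  obtain ⟨g, hgeo, hg0, hg1, hgr⟩ := hr.seg hd hj1 hj0
  have key := hF.hexagon hd hle hg k k (γ₁ := fun t => p (i₀ + t)) (ℓ₁ := i₁ - i₀) (γ₂ := g)
    (γ₃ := fun _ => r j₀) (ℓ₃ := 0) (hp.sub (by omega)) hgeo
    (fun a b _ _ => by rw [hd.self]; omega)
    (by rw [Nat.add_sub_cancel' (by omega), hg0]; exact hd1)
    (by rw [hg1, hd.self]; omega)
    (by rw [hd.symm]; exact hd0)
    (by
      intro t ht u hu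
      obtain ⟨v, hv, h⟩ := hgr u hu
      rw [h]
      exact hfar _ (by omega) (by omega) v hv)
    (fun t ht u hu => hfar _ (by omega) (by omega) _ hj0)
  have hl2 : d (r j₁) (r j₀) ≤ (i₁ - i₀) + 2 * k := by
    have e1 := hd.tri (r j₁) (p i₁) (r j₀)
    have e2 := hd.tri (p i₁) (p i₀) (r j₀)
    have e3 := hp i₀ i₁ (by omega) (by omega)
    rw [hd.symm (r j₁) (p i₁)] at e1
    rw [hd.symm (p i₁) (p i₀)] at e2
    omega
  have hlen : i₁ - i₀ ≤ C * (5 * k) + k * (3 * k) := by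
    have e1 := Nat.mul_le_mul_left C hl2
    have e2 : k * (i₁ - i₀) = 3 * (C * (i₁ - i₀)) + (i₁ - i₀) := by rw [hk]; ring
    generalize i₁ - i₀ = x at *
    nlinarith [Nat.zero_le (C * x)]
  refine ⟨j₀, hj0, ?_⟩
  have e1 := hd.tri (p s) (p i₀) (r j₀)
  have e2 := hp i₀ s h0s (by omega)
  rw [hd.symm] at e2
  omega

/-- Geodesic triangles are uniformly slim. -/
theorem LinFill.slim {C : ℕ} (hF : LinFill d dX C) (hd : IsPseudoDist d)
    (hle : ∀ a b, d a b ≤ dX a b) (hg : HasGeo d) :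
    ∃ δ, ∀ (p q r : ℕ → V) (a b c : ℕ), IsGeo d p a → IsGeo d q b → IsGeo d r c →
      p a = q 0 → q b = r 0 → r c = p 0 → ∀ s ≤ a,
        (∃ j ≤ b, d (p s) (q j) ≤ δ) ∨ ∃ j ≤ c, d (p s) (r j) ≤ δ := by
  classical
  obtain ⟨M, hkM, hM⟩ := hF.near_of_near_ends hd hle hg
  set k := 3 * C + 1 with hk
  refine ⟨M + 3 * (C * (3 * k)) + 3 * (k * (3 * k)), ?_⟩
  intro p q r a b c hp hq hr hpq hqr hrp s hs
  let P : ℕ → Prop := fun t => ∃ j ≤ c, d (p t) (r j) ≤ k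
  let Q : ℕ → Prop := fun t => ∃ j ≤ b, d (p t) (q j) ≤ k
  have hP0 : P 0 := ⟨c, le_rfl, by rw [hrp, hd.self]; omega⟩
  have hQa : Q a := ⟨0, by omega, by rw [hpq, hd.self]; omega⟩
  obtain ⟨i, hia, hPi, hmax⟩ : ∃ i ≤ a, P i ∧ ∀ t, i < t → t ≤ a → ¬ P t :=
    ⟨Nat.findGreatest P a, Nat.findGreatest_le a, Nat.findGreatest_spec (Nat.zero_le a) hP0,
      fun t h1 h2 => Nat.findGreatest_is_greatest h1 h2⟩
  rcases le_or_gt s i with hsi | hsi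
  · obtain ⟨j, hj, h⟩ := hM p r a c hp hr 0 s i (by omega) hsi hia hP0 hPi
    exact .inr ⟨j, hj, by omega⟩
  have hex : ∃ t, Q t := ⟨a, hQa⟩
  have hQ' := Nat.find_spec hex
  have hmin : ∀ t, t < Nat.find hex → ¬ Q t := fun t h1 => Nat.find_min hex h1
  have hia' : Nat.find hex ≤ a := Nat.find_min' hex hQa
  generalize Nat.find hex = i' at *
  rcases le_or_gt i' s with hsi' | hsi'
  · obtain ⟨j, hj, h⟩ := hM p q a b hp hq i' s a hsi' hs le_rfl hQ' hQa
    exact .inl ⟨j, hj, by omega⟩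
  have hfarr : ∀ t, i ≤ t → t ≤ i' → ∀ j ≤ c, k ≤ d (p t) (r j) := by
    intro t h1 h2 j hj
    by_contra hc
    rcases h1.eq_or_lt with h | h
    · have e1 : k < d (p (t + 1)) (r j) := by
        by_contra hc'
        exact hmax (t + 1) (by omega) (by omega) ⟨j, hj, by omega⟩
      have e2 := hp.step (t := t) (by omega)
      have e3 := hd.tri (p (t + 1)) (p t) (r j)
      rw [hd.symm (p (t + 1)) (p t)] at e3
      omega
    · exact hmax t h (by omega) ⟨j, hj, by omega⟩
  have hfarq : ∀ t, i ≤ t → t ≤ i' → ∀ j ≤ b, k ≤ d (p t) (q j) := by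
    intro t h1 h2 j hj
    by_contra hc
    rcases h2.eq_or_lt with h | h
    · obtain ⟨t, rfl⟩ : ∃ u, t = u + 1 := ⟨t - 1, by omega⟩
      have e1 : k < d (p t) (q j) := by
        by_contra hc'
        exact hmin t (by omega) ⟨j, hj, by omega⟩
      have e2 := hp.step (t := t) (by omega)
      have e3 := hd.tri (p t) (p (t + 1)) (q j)
      omega
    · exact hmin t h ⟨j, hj, by omega⟩
  obtain ⟨jr, hjr, hdr⟩ := hPi
  obtain ⟨jq, hjq, hdq⟩ := hQ'
  have hexpair : ∃ n, ∃ x y, jq + x ≤ b ∧ y ≤ jr ∧ n = x + y ∧ d (q (jq + x)) (r (jr - y)) ≤ k :=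
    ⟨_, b - jq, jr, by omega, le_rfl, rfl, by
      rw [Nat.add_sub_cancel' hjq, Nat.sub_self, hqr, hd.self]; omega⟩
  obtain ⟨x, y, hx, hy, hxy, hdxy⟩ := Nat.find_spec hexpair
  have hmin2 : ∀ x' y', x' + y' < x + y → x' ≤ x → y' ≤ y →
      k < d (q (jq + x')) (r (jr - y')) := by
    intro x' y' h1 h2 h3
    by_contra hc
    exact Nat.find_min hexpair (m := x' + y') (by omega)
      ⟨x', y', by omega, by omega, rfl, by omega⟩
  have hfarqr : 0 < x + y → ∀ x' ≤ x, ∀ y' ≤ y, k ≤ d (q (jq + x')) (r (jr - y')) := by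
    intro hpos x' hx' y' hy'
    by_cases h : x' + y' < x + y
    · exact (hmin2 x' y' h hx' hy').le
    obtain rfl : x' = x := by omega
    obtain rfl : y' = y := by omega
    rcases Nat.eq_zero_or_pos x' with h0 | h0
    · obtain ⟨y, rfl⟩ : ∃ u, y' = u + 1 := ⟨y' - 1, by omega⟩
      have e1 := hmin2 x' y (by omega) le_rfl (by omega)
      have e2 := hr.step (t := jr - (y + 1)) (by omega)
      rw [show jr - (y + 1) + 1 = jr - y by omega] at e2
      have e3 := hd.tri (q (jq + x')) (r (jr - (y + 1))) (r (jr - y))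
      omega
    · obtain ⟨x, rfl⟩ : ∃ u, x' = u + 1 := ⟨x' - 1, by omega⟩
      have e1 := hmin2 x y' (by omega) (by omega) le_rfl
      have e2 := hq.step (t := jq + x) (by omega)
      have e3 := hd.tri (q (jq + x)) (q (jq + x + 1)) (r (jr - y'))
      rw [show jq + (x + 1) = jq + x + 1 by omega]
      omega
  have gp : IsGeo d (fun t => p (i + t)) (i' - i) := hp.sub (by omega)
  have gq : IsGeo d (fun t => q (jq + t)) x := hq.sub hx
  have gr : IsGeo d (fun t => r (jr - y + t)) y := hr.sub (by omega)
  have c1 : d (p (i + (i' - i))) (q (jq + 0)) ≤ k := by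
    rw [Nat.add_sub_cancel' (by omega)]; exact hdq
  have c2 : d (q (jq + x)) (r (jr - y + 0)) ≤ k := hdxy
  have c3 : d (r (jr - y + y)) (p (i + 0)) ≤ k := by
    rw [Nat.sub_add_cancel hy, hd.symm]; exact hdr
  have b1 := hF.hexagon hd hle hg k k gp gq gr c1 c2 c3
    (fun t ht u hu => hfarq _ (by omega) (by omega) _ (by omega))
    (fun t ht u hu => hfarr _ (by omega) (by omega) _ (by omega))
  have b2 : k * x ≤ C * (x + y + (i' - i) + 3 * k) + k * (3 * k) := by
    rcases Nat.eq_zero_or_pos x with h0 | h0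
    · simp [h0]
    refine hF.hexagon hd hle hg k k gq gr gp c2 c3 c1 (fun t ht u hu => ?_) fun t ht u hu => ?_
    · have := hfarqr (by omega) t ht (y - u) (by omega)
      rwa [show jr - (y - u) = jr - y + u by omega] at this
    · rw [hd.symm]
      exact hfarq _ (by omega) (by omega) _ (by omega)
  have b3 : k * y ≤ C * (y + (i' - i) + x + 3 * k) + k * (3 * k) := by
    rcases Nat.eq_zero_or_pos y with h0 | h0
    · simp [h0]
    refine hF.hexagon hd hle hg k k gr gp gq c3 c1 c2 (fun t ht u hu => ?_) fun t ht u hu => ?_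
    · rw [hd.symm]
      exact hfarr _ (by omega) (by omega) _ (by omega)
    · rw [hd.symm]
      have := hfarqr (by omega) u hu (y - t) (by omega)
      rwa [show jr - (y - t) = jr - y + t by omega] at this
  have hlen : i' - i ≤ 3 * (C * (3 * k)) + 3 * (k * (3 * k)) := by
    generalize i' - i = z at *
    have e1 : k * z = 3 * (C * z) + z := by rw [hk]; ring
    have e2 : k * x = 3 * (C * x) + x := by rw [hk]; ring
    have e3 : k * y = 3 * (C * y) + y := by rw [hk]; ring
    rw [e1] at b1; rw [e2] at b2; rw [e3] at b3
    have f1 : C * (z + x + y + 3 * k) = C * z + C * x + C * y + C * (3 * k) := by ring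
    have f2 : C * (x + y + z + 3 * k) = C * z + C * x + C * y + C * (3 * k) := by ring
    have f3 : C * (y + z + x + 3 * k) = C * z + C * x + C * y + C * (3 * k) := by ring
    omega
  refine .inl ⟨jq, hjq, ?_⟩
  have e1 := hd.tri (p s) (p i') (q jq)
  have e2 := hp s i' hsi'.le hia'
  omega

theorem EPath.dist_le (hd : IsPseudoDist d) {a b : V} {n e : ℕ} (h : EPath d E a b n e) :
    d a b ≤ n := by
  induction h with
  | refl => rw [hd.self]; omega
  | @step b c _ _ _ hbc _ ih => have := hd.tri a b c; omega
  | @jump b c _ _ _ hbc ih => have := hd.tri a b c; omega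

theorem exists_switch {P Q : ℕ → Prop} {i j : ℕ} (hij : i ≤ j)
    (h : ∀ t, i ≤ t → t ≤ j → P t ∨ Q t) (hi : P i) (hj : Q j) :
    ∃ t, i ≤ t ∧ t ≤ j ∧ P t ∧ (Q t ∨ t + 1 ≤ j ∧ Q (t + 1)) := by
  induction j, hij using Nat.le_induction with
  | base => exact ⟨i, le_rfl, le_rfl, hi, .inl hj⟩
  | succ j hij ih =>
    rcases h j hij (by omega) with h' | h'
    · exact ⟨j, hij, by omega, h', .inr ⟨le_rfl, hj⟩⟩
    · obtain ⟨t, h1, h2, h3, h4⟩ := ih (fun t h1 h2 => h t h1 (by omega)) h'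
      exact ⟨t, h1, by omega, h3, h4.imp_right fun h => ⟨by omega, h.2⟩⟩

/-- The edges along which the cut at level `s` of the distance to `x`, weighted by a function
supported away from `Q`, vanishes. -/
def CutFree (d : V → V → ℕ) (Q : Set V) (x : V) (s : ℕ) (a b : V) : Prop :=
  (a ∈ Q ∧ b ∈ Q) ∨ (d x a < s ∧ d x b < s) ∨ (s < d x a ∧ s < d x b)

theorem CutFree.symm {Q : Set V} {x : V} {s : ℕ} {a b : V} (h : CutFree d Q x s a b) :
    CutFree d Q x s b a := by
  unfold CutFree at *; tauto

theorem epath_cutFree_below (hd : IsPseudoDist d) (hg : HasGeo d) {Q : Set V} {x a b : V}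
    {s n : ℕ} (hab : d a b ≤ n) (ha : d x a + n < s) : EPath d (CutFree d Q x s) a b n 0 := by
  obtain ⟨γ, h0, h1, hγ⟩ := hg a b
  have hv : ∀ t ≤ d a b, d x (γ t) < s := fun t ht => by
    have e1 := hγ 0 t (by omega) ht
    have e2 := hd.tri x a (γ t)
    rw [h0] at e1
    omega
  have := hγ.epath (E := CutFree d Q x s) fun t ht =>
    .inr (.inl ⟨hv t (by omega), hv (t + 1) (by omega)⟩)
  rw [h0, h1] at this
  exact this.mono hab le_rfl

theorem epath_cutFree_above (hd : IsPseudoDist d) (hg : HasGeo d) {Q : Set V} {x a b : V}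
    {s n : ℕ} (hab : d a b ≤ n) (ha : s + n < d x a) : EPath d (CutFree d Q x s) a b n 0 := by
  obtain ⟨γ, h0, h1, hγ⟩ := hg a b
  have hv : ∀ t ≤ d a b, s < d x (γ t) := fun t ht => by
    have e1 := hγ 0 t (by omega) ht
    have e2 := hd.tri x (γ t) a
    rw [h0, hd.symm] at e1
    omega
  have := hγ.epath (E := CutFree d Q x s) fun t ht =>
    .inr (.inr ⟨hv t (by omega), hv (t + 1) (by omega)⟩)
  rw [h0, h1] at this
  exact this.mono hab le_rfl

theorem epath_cutFree_seg (hd : IsPseudoDist d) {Q : Set V} {x : V} {s n i j : ℕ} {γ : ℕ → V}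
    (hγ : IsGeo d γ n) (hQ : ∀ t ≤ n, γ t ∈ Q) (hi : i ≤ n) (hj : j ≤ n) :
    EPath d (CutFree d Q x s) (γ i) (γ j) (d (γ i) (γ j)) 0 := by
  obtain ⟨g, hg, h0, h1, hu⟩ := hγ.seg hd hi hj
  have hgQ : ∀ t ≤ d (γ i) (γ j), g t ∈ Q := fun t ht => by
    obtain ⟨u, hu, h⟩ := hu t ht
    exact h ▸ hQ u hu
  have := hg.epath (E := CutFree d Q x s) fun t ht =>
    .inl ⟨hgQ t (by omega), hgQ (t + 1) (by omega)⟩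
  rwa [h0, h1] at this

/-- If a geodesic segment through a point `p s` is closed up to a loop by a path crossing the
level `s` only at `dX`-distance at least `N` from `p s`, then `N` is at most linear in the length
of the loop. -/
theorem LinFill.cut_bound {C : ℕ} (hF : LinFill d dX C) (hd : IsPseudoDist d)
    (hdX : IsPseudoDist dX) {p : ℕ → V} {a s s₁ s₂ n N : ℕ} (hp : IsGeo d p a) (h₁ : s₁ < s)
    (h₂ : s ≤ s₂) (h₂a : s₂ ≤ a)
    (hpath : EPath d (CutFree d {u | N ≤ dX u (p s)} (p 0) s) (p s₂) (p s₁) n 0) :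
    N ≤ C * (s₂ - s₁ + n) := by
  set ρ : V → ℤ := fun u => ((N - dX u (p s) : ℕ) : ℤ) with hρ
  set β : V → ℤ := fun u => if s ≤ d (p 0) u then 1 else 0 with hβ
  have hβlip : Lip d β := fun u v => by
    have := hd.tri (p 0) u v
    simp only [hβ]
    split_ifs <;> omega
  obtain ⟨m, hm, hmain⟩ := hF ρ β (fun u v => by
    have := hdX.tri u v (p s)
    simp only [hρ]
    omega) hβlip
  have hβ01 : ∀ u, β u = 0 ∨ β u = 1 := fun u => by simp only [hβ]; split_ifs <;> simp
  have hlow : ∀ u v, d u v ≤ 1 → d (p 0) u < s → d (p 0) v < s → edgeForm ρ β m u v = 0 := by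
    intro u v huv hu hv
    obtain ⟨e1, -, c, -, -, hc⟩ := hm u v huv
    have hu0 : β u = 0 := by simp [hβ, hu]
    have hv0 : β v = 0 := by simp [hβ, hv]
    have : m u v = 0 := by rcases hβ01 c with h | h <;> omega
    simp [edgeForm, hu0, hv0, this]
  have hhigh : ∀ u v, d u v ≤ 1 → s ≤ d (p 0) u → s ≤ d (p 0) v →
      (s < d (p 0) u ∨ s < d (p 0) v) → edgeForm ρ β m u v = 0 := by
    intro u v huv hu hv hs
    obtain ⟨-, -, c, hcu, hcv, hc⟩ := hm u v huv
    have hu1 : β u = 1 := by simp [hβ, hu]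
    have hv1 : β v = 1 := by simp [hβ, hv]
    have hc1 : β c = 1 := by
      have e1 := hd.tri (p 0) c u
      have e2 := hd.tri (p 0) c v
      simp only [hβ]
      rw [if_pos (by omega)]
    simp [edgeForm, hu1, hv1, ← hc, hc1]
  have hlev : ∀ t ≤ a, d (p 0) (p t) = t := fun t ht => by rw [hp 0 t (by omega) ht]; omega
  have hseg : IsGeo d (fun t => p (s₁ + t)) (s₂ - s₁) := hp.sub (by omega)
  have r1 : Reach d (edgeForm ρ β m) (p (s₁ + 0)) (p (s₁ + (s₂ - s₁))) (s₂ - s₁)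
      (∑ t ∈ Finset.range (s₂ - s₁), if t = s - 1 - s₁ then (N : ℤ) else 0) := by
    refine reach_of_seq (γ := fun t => p (s₁ + t)) _ (fun t ht => hseg.step ht) fun t ht => ?_
    have hst := hseg.step ht
    have e1 := hlev (s₁ + t) (by omega)
    have e2 := hlev (s₁ + (t + 1)) (by omega)
    rcases lt_trichotomy t (s - 1 - s₁) with h | h | h
    · rw [if_neg (by omega), hlow _ _ hst (by omega) (by omega)]
    · rw [if_pos h]
      obtain ⟨f1, -, c, -, -, hc⟩ := hm _ _ hst
      have hu0 : β (p (s₁ + t)) = 0 := by simp only [hβ]; rw [if_neg (by omega)]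
      have hv1 : β (p (s₁ + (t + 1))) = 1 := by simp only [hβ]; rw [if_pos (by omega)]
      have : m (p (s₁ + t)) (p (s₁ + (t + 1))) = 0 := by rcases hβ01 c with h | h <;> omega
      simp only [edgeForm, hu0, hv1, this]
      rw [show s₁ + (t + 1) = s by omega]
      simp [hρ, hdX.self]
    · rw [if_neg (by omega), hhigh _ _ hst (by omega) (by omega) (.inr (by omega))]
  rw [Finset.sum_ite_eq' _ _ _, if_pos (by simp; omega), Nat.add_sub_cancel' (by omega),
    Nat.add_zero] at r1
  have r2 := hpath.reach (φ := edgeForm ρ β m) (k := N)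
    (fun u v huv hE => by
      rcases hE with ⟨h1, h2⟩ | ⟨h1, h2⟩ | ⟨h1, h2⟩
      · have e1 : ρ u = 0 := by simp only [hρ, Set.mem_ofPred_eq] at *; omega
        have e2 : ρ v = 0 := by simp only [hρ, Set.mem_ofPred_eq] at *; omega
        simp [edgeForm, e1, e2]
      · exact (hlow u v huv h1 h2).ge
      · exact (hhigh u v huv h1.le h2.le (.inl h1)).ge)
    (fun u v huv => edgeForm_ge hβlip hm (fun u => by simp only [hρ]; positivity)
      (fun u => by simp only [hρ]; exact_mod_cast Nat.sub_le _ _) huv)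
  have := hmain _ _ _ (r1.trans r2)
  zify
  push_cast at this
  linarith

/-- Geodesic triangles for `d` are uniformly slim with respect to `dX`. -/
theorem LinFill.slim_strong {C : ℕ} (hF : LinFill d dX C) (hd : IsPseudoDist d)
    (hdX : IsPseudoDist dX) (hle : ∀ a b, d a b ≤ dX a b) (hg : HasGeo d) :
    ∃ ν, ∀ (p q r : ℕ → V) (a b c : ℕ), IsGeo d p a → IsGeo d q b → IsGeo d r c →
      p a = q 0 → q b = r 0 → r c = p 0 → ∀ s ≤ a,
        (∃ j ≤ b, dX (q j) (p s) ≤ ν) ∨ ∃ j ≤ c, dX (r j) (p s) ≤ ν := by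
  obtain ⟨δ, hδ⟩ := hF.slim hd hle hg
  refine ⟨C * (30 * (δ + 1)), fun p q r a b c hp hq hr hpq hqr hrp s hs => ?_⟩
  by_contra hcon
  push Not at hcon
  obtain ⟨hconq, hconr⟩ := hcon
  set N := C * (30 * (δ + 1)) + 1 with hN
  have hs0 : s ≠ 0 := by
    rintro rfl
    have := hconr c le_rfl
    rw [hrp, hdX.self] at this
    omega
  set Q : Set V := {u | N ≤ dX u (p s)} with hQ
  have hqQ : ∀ t ≤ b, q t ∈ Q := fun t ht => hconq t ht
  have hrQ : ∀ t ≤ c, r t ∈ Q := fun t ht => hconr t ht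
  have hlev : ∀ t ≤ a, d (p 0) (p t) = t := fun t ht => by rw [hp 0 t (by omega) ht]; omega
  obtain ⟨s₁, hs₁⟩ : ∃ s₁, s₁ = s - (δ + 1) := ⟨_, rfl⟩
  obtain ⟨s₂, hs₂, hs₂a, hs₂δ, hs₂'⟩ : ∃ s₂, s ≤ s₂ ∧ s₂ ≤ a ∧ s₂ ≤ s + (δ + 1) ∧
      (s₂ = a ∨ s₂ = s + (δ + 1)) := by
    rcases le_total a (s + (δ + 1)) with h | h
    · exact ⟨a, by omega, le_rfl, h, .inl rfl⟩
    · exact ⟨s + (δ + 1), by omega, h, le_rfl, .inr rfl⟩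
  have hloop : ∀ n, EPath d (CutFree d Q (p 0) s) (p s₂) (p s₁) n 0 →
      30 * (δ + 1) < s₂ - s₁ + n := by
    intro n hn
    have := hF.cut_bound hd hdX hp (by omega) (by omega) (by omega) hn
    by_contra hc
    have := Nat.mul_le_mul_left C (not_lt.mp hc)
    omega
  have hsym : ∀ {u v n}, EPath d (CutFree d Q (p 0) s) u v n 0 →
      EPath d (CutFree d Q (p 0) s) v u n 0 := fun h => h.symm hd fun _ _ => CutFree.symm
  have hp12 := hp s₁ s₂ (by omega) (by omega)
  have same : ∀ (g : ℕ → V) (n : ℕ), IsGeo d g n → (∀ t ≤ n, g t ∈ Q) → ∀ i ≤ n, ∀ j ≤ n,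
      EPath d (CutFree d Q (p 0) s) (p s₁) (g i) δ 0 →
      EPath d (CutFree d Q (p 0) s) (p s₂) (g j) δ 0 → False := by
    intro g n hgeo hgQ i hi j hj h1 h2
    have e0 := hloop _ ((h2.trans (epath_cutFree_seg hd hgeo hgQ hj hi)).trans (hsym h1))
    have e1 := h1.dist_le hd
    have e2 := h2.dist_le hd
    have e3 := hd.tri (g j) (p s₂) (g i)
    have e4 := hd.tri (p s₂) (p s₁) (g i)
    rw [hd.symm (g j) (p s₂)] at e3
    rw [hd.symm (p s₂) (p s₁)] at e4
    omega
  -- a short path between the two other sides, far from the level `s`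
  have bridge : ∀ t, s₁ ≤ t → t ≤ s₂ → (∃ j ≤ b, d (p t) (q j) ≤ δ + 1) →
      (∃ j ≤ c, d (p t) (r j) ≤ δ + 1) → ∀ e ≤ b, ∀ f ≤ c, ∀ x y, s₁ ≤ x → x ≤ s₂ → s₁ ≤ y →
      y ≤ s₂ → d (p x) (q e) ≤ δ → d (p y) (r f) ≤ δ →
      EPath d (CutFree d Q (p 0) s) (q e) (r f) (25 * (δ + 1)) 0 := by
    rintro t ht1 ht2 ⟨m, hm, hdm⟩ ⟨m', hm', hdm'⟩ e he f hf x y hx1 hx2 hy1 hy2 hxe hyf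
    have hpd : ∀ x y, s₁ ≤ x → x ≤ s₂ → s₁ ≤ y → y ≤ s₂ → d (p x) (p y) ≤ 2 * (δ + 1) := by
      intro x y hx1 hx2 hy1 hy2
      rcases le_total x y with h | h
      · rw [hp x y h (by omega)]; omega
      · rw [hd.symm, hp y x h (by omega)]; omega
    have hxt := hpd x t hx1 hx2 ht1 ht2
    have hyt := hpd y t hy1 hy2 ht1 ht2
    obtain ⟨j, u, hmj, hj, hjT, hu, hju⟩ : ∃ j u, m ≤ j ∧ j ≤ b ∧ j ≤ m + (7 * δ + 5) ∧ u ≤ c ∧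
        EPath d (CutFree d Q (p 0) s) (q j) (r u) δ 0 := by
      rcases le_or_gt b (m + (7 * δ + 5)) with hb | hb
      · exact ⟨b, 0, hm, le_rfl, hb, by omega, hqr ▸ .refl _ _⟩
      obtain ⟨g, hg0, hg1, hgeo⟩ := hg (r m') (q m)
      have hlg : d (r m') (q m) ≤ 2 * δ + 2 := by
        have := hd.tri (r m') (p t) (q m)
        rw [hd.symm (r m') (p t)] at this
        omega
      have hsub : IsGeo d (fun t => q (m + t)) (b - m) := hq.sub (by omega)
      have hr' : IsGeo d r m' := fun i j hij hj => hr i j hij (by omega)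
      rcases hδ _ r g (b - m) m' _ hsub hr' hgeo (by rw [Nat.add_sub_cancel' hm, hqr])
        hg0.symm (by simpa using hg1) (7 * δ + 5) (by omega) with ⟨u, hu, hju⟩ | ⟨i, hi, hji⟩
      · refine ⟨m + (7 * δ + 5), u, by omega, by omega, le_rfl, by omega, ?_⟩
        replace hju : d (q (m + (7 * δ + 5))) (r u) ≤ δ := hju
        apply epath_cutFree_above hd hg hju
        have f1 := hr u m' hu hm'
        have f2 := hr m' c hm' le_rfl
        have f3 := hr u c (by omega) le_rfl
        have f4 := hq m (m + (7 * δ + 5)) (by omega) (by omega)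
        have f5 := hd.tri (q m) (r m') (q (m + (7 * δ + 5)))
        have f6 := hd.tri (r m') (r u) (q (m + (7 * δ + 5)))
        have f7 := hd.tri (p 0) (r m') (p t)
        have f8 := hlev t (by omega)
        have f9 := hd.tri (p 0) (q (m + (7 * δ + 5))) (r u)
        rw [hd.symm (q m) (r m')] at f5
        rw [hd.symm (r m') (r u), hd.symm (r u) (q _)] at f6
        rw [hrp] at f2 f3
        rw [hd.symm (p 0) (r m'), hd.symm (r m') (p t)] at f7
        rw [hd.symm (p 0) (r u)] at f9
        omega
      · exfalso
        have f1 := hgeo i _ hi le_rfl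
        have f2 := hd.tri (q (m + (7 * δ + 5))) (g i) (q m)
        have f3 := hq m (m + (7 * δ + 5)) (by omega) (by omega)
        rw [hg1] at f1
        rw [hd.symm (q (m + (7 * δ + 5))) (q m)] at f2
        replace hji : d (q (m + (7 * δ + 5))) (g i) ≤ δ := hji
        omega
    have hE := ((epath_cutFree_seg (x := p 0) (s := s) hd hq hqQ he hj).trans hju).trans
      (epath_cutFree_seg hd hr hrQ hu hf)
    refine hE.mono ?_ le_rfl
    have f1 := hju.dist_le hd
    have f2 := hq m j hmj hj
    have g1 := hd.tri (q e) (p x) (q j)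
    have g2 := hd.tri (p x) (p t) (q j)
    have g3 := hd.tri (p t) (q m) (q j)
    have g4 := hd.tri (r u) (q j) (r f)
    have g5 := hd.tri (q j) (q m) (r f)
    have g6 := hd.tri (q m) (p t) (r f)
    have g7 := hd.tri (p t) (p y) (r f)
    rw [hd.symm (q e) (p x)] at g1
    rw [hd.symm (r u) (q j)] at g4
    rw [hd.symm (q j) (q m)] at g5
    rw [hd.symm (q m) (p t)] at g6
    rw [hd.symm (p t) (p y)] at g7
    omega
  have hcover : ∀ t, s₁ ≤ t → t ≤ s₂ →
      (∃ j ≤ b, d (p t) (q j) ≤ δ) ∨ ∃ j ≤ c, d (p t) (r j) ≤ δ := fun t _ _ =>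
    hδ p q r a b c hp hq hr hpq hqr hrp t (by omega)
  have hnext : ∀ t, t + 1 ≤ s₂ → ∀ u, d (p (t + 1)) u ≤ δ → d (p t) u ≤ δ + 1 := by
    intro t ht u hu
    have e1 := hp.step (t := t) (by omega)
    have e2 := hd.tri (p t) (p (t + 1)) u
    omega
  have anchor₁ : (∃ j ≤ b, EPath d (CutFree d Q (p 0) s) (p s₁) (q j) δ 0) ∨
      ∃ j ≤ c, EPath d (CutFree d Q (p 0) s) (p s₁) (r j) δ 0 := by
    rcases Nat.lt_or_ge s (δ + 1) with h | h
    · right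
      refine ⟨c, le_rfl, ?_⟩
      rw [hrp, show s₁ = 0 by omega]
      exact .refl _ _
    have hl := hlev s₁ (by omega)
    rcases hδ p q r a b c hp hq hr hpq hqr hrp s₁ (by omega) with ⟨j, hj, h'⟩ | ⟨j, hj, h'⟩
    · exact .inl ⟨j, hj, epath_cutFree_below hd hg h' (by omega)⟩
    · exact .inr ⟨j, hj, epath_cutFree_below hd hg h' (by omega)⟩
  have anchor₂ : (∃ j ≤ b, EPath d (CutFree d Q (p 0) s) (p s₂) (q j) δ 0) ∨
      ∃ j ≤ c, EPath d (CutFree d Q (p 0) s) (p s₂) (r j) δ 0 := by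
    rcases Nat.lt_or_ge a (s + (δ + 1)) with h | h
    · left
      refine ⟨0, by clear anchor₁; omega, ?_⟩
      rw [← hpq, show s₂ = a by clear anchor₁; omega]
      exact .refl _ _
    have hl := hlev s₂ (by clear anchor₁; omega)
    rcases hδ p q r a b c hp hq hr hpq hqr hrp s₂ (by clear anchor₁; omega) with ⟨j, hj, h'⟩ | ⟨j, hj, h'⟩
    · exact .inl ⟨j, hj, epath_cutFree_above hd hg h' (by clear anchor₁; omega)⟩
    · exact .inr ⟨j, hj, epath_cutFree_above hd hg h' (by clear anchor₁; omega)⟩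
  have hs12 : s₁ ≤ s₂ := by clear anchor₁ anchor₂; omega
  rcases anchor₁ with ⟨i, hi, hEi⟩ | ⟨i, hi, hEi⟩ <;> rcases anchor₂ with ⟨j, hj, hEj⟩ | ⟨j, hj, hEj⟩
  · exact same q b hq hqQ i hi j hj hEi hEj
  · obtain ⟨t, h1, h2, ⟨x, hx, hxd⟩, h4⟩ := exists_switch hs12 hcover
      ⟨i, hi, hEi.dist_le hd⟩ ⟨j, hj, hEj.dist_le hd⟩
    have hB := bridge t h1 h2 ⟨x, hx, hxd.trans δ.le_succ⟩ (by
      rcases h4 with ⟨y, hy, hyd⟩ | ⟨ht, y, hy, hyd⟩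
      · exact ⟨y, hy, hyd.trans δ.le_succ⟩
      · exact ⟨y, hy, hnext t ht _ hyd⟩) i hi j hj s₁ s₂ le_rfl hs12 hs12 le_rfl
      (hEi.dist_le hd) (hEj.dist_le hd)
    have := hloop _ ((hEj.trans (hsym hB)).trans (hsym hEi))
    clear h4
    omega
  · obtain ⟨t, h1, h2, ⟨x, hx, hxd⟩, h4⟩ := exists_switch hs12
      (fun t h1 h2 => (hcover t h1 h2).symm) ⟨i, hi, hEi.dist_le hd⟩ ⟨j, hj, hEj.dist_le hd⟩
    have hB := bridge t h1 h2 (by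
      rcases h4 with ⟨y, hy, hyd⟩ | ⟨ht, y, hy, hyd⟩
      · exact ⟨y, hy, hyd.trans δ.le_succ⟩
      · exact ⟨y, hy, hnext t ht _ hyd⟩) ⟨x, hx, hxd.trans δ.le_succ⟩ j hj i hi s₂ s₁ hs12 le_rfl le_rfl
      hs12 (hEj.dist_le hd) (hEi.dist_le hd)
    have := hloop _ ((hEj.trans hB).trans (hsym hEi))
    clear h4
    omega
  · exact same r c hr hrQ i hi j hj hEi hEj

end Geometry

section WordLength

variable {G : Type*} [Group G] {S T : Set G}

theorem wordLength_le {w : List G} (hw : ∀ x ∈ w, x ∈ S ∨ x⁻¹ ∈ S) :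
    wordLength S w.prod ≤ w.length :=
  Nat.sInf_le ⟨w, rfl, hw, rfl⟩

theorem exists_word (hS : Subgroup.closure S = ⊤) (g : G) :
    ∃ w : List G, w.length = wordLength S g ∧ (∀ x ∈ w, x ∈ S ∨ x⁻¹ ∈ S) ∧ w.prod = g := by
  refine Nat.sInf_mem
    (s := {n | ∃ w : List G, w.length = n ∧ (∀ x ∈ w, x ∈ S ∨ x⁻¹ ∈ S) ∧ w.prod = g}) ?_
  obtain ⟨w, hw, hg⟩ := Submonoid.exists_list_of_mem_closure (s := S ∪ S⁻¹) (x := g)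
    (by simp [← Subgroup.closure_toSubmonoid, hS])
  exact ⟨_, w, rfl, hw, hg⟩

theorem wordLength_one : wordLength S (1 : G) = 0 :=
  Nat.le_zero.mp (wordLength_le (S := S) (w := []) (by simp))

theorem wordLength_inv_le (hS : Subgroup.closure S = ⊤) (g : G) :
    wordLength S g⁻¹ ≤ wordLength S g := by
  obtain ⟨w, hl, hw, rfl⟩ := exists_word hS g
  rw [List.prod_inv_reverse, ← hl]
  refine (wordLength_le fun x hx => ?_).trans (by simp)
  obtain ⟨y, hy, rfl⟩ := List.mem_map.mp (List.mem_reverse.mp hx)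
  simpa [or_comm] using hw y hy

theorem wordLength_inv (hS : Subgroup.closure S = ⊤) (g : G) :
    wordLength S g⁻¹ = wordLength S g :=
  (wordLength_inv_le hS g).antisymm (by simpa using wordLength_inv_le hS g⁻¹)

theorem wordLength_mul_le (hS : Subgroup.closure S = ⊤) (g h : G) :
    wordLength S (g * h) ≤ wordLength S g + wordLength S h := by
  obtain ⟨w, hl, hw, rfl⟩ := exists_word hS g
  obtain ⟨v, hl', hv, rfl⟩ := exists_word hS h
  rw [← List.prod_append, ← hl, ← hl', ← List.length_append]
  exact wordLength_le fun x hx => (List.mem_append.mp hx).elim (hw x) (hv x)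

theorem wordLength_anti (hS : Subgroup.closure S = ⊤) (hST : S ⊆ T) (g : G) :
    wordLength T g ≤ wordLength S g := by
  obtain ⟨w, hl, hw, rfl⟩ := exists_word hS g
  exact hl ▸ wordLength_le fun x hx => (hw x hx).imp (@hST _) (@hST _)

theorem wordLength_le_one_of_mem {g : G} (hg : g ∈ S) : wordLength S g ≤ 1 := by
  simpa using wordLength_le (S := S) (w := [g]) (by simpa using .inl hg)

theorem mem_of_wordLength_le_one (hS : Subgroup.closure S = ⊤) {g : G} (hg : wordLength S g ≤ 1) :
    g = 1 ∨ g ∈ S ∨ g⁻¹ ∈ S := by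
  obtain ⟨w, hl, hw, rfl⟩ := exists_word hS g
  match w with
  | [] => exact .inl rfl
  | [x] => exact .inr (by simpa using hw x (by simp))
  | _ :: _ :: _ => rw [← hl] at hg; simp at hg

theorem isPseudoDist_wordLength (hS : Subgroup.closure S = ⊤) :
    IsPseudoDist fun a b : G => wordLength S (a⁻¹ * b) where
  self a := by simp [wordLength_one]
  symm a b := by rw [← wordLength_inv hS]; simp
  tri a b c := by
    have := wordLength_mul_le hS (a⁻¹ * b) (b⁻¹ * c)
    rwa [mul_assoc, mul_inv_cancel_left] at this

theorem hasGeo_wordLength (hS : Subgroup.closure S = ⊤) :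
    HasGeo fun a b : G => wordLength S (a⁻¹ * b) := by
  intro a b
  obtain ⟨w, hl, hw, hg⟩ := exists_word hS (a⁻¹ * b)
  have hd := isPseudoDist_wordLength hS
  have h0 : a * (w.take 0).prod = a := by simp
  have h1 : a * (w.take w.length).prod = b := by rw [List.take_length, hg, mul_inv_cancel_left]
  have hle : ∀ i j, i ≤ j →
      wordLength S ((a * (w.take i).prod)⁻¹ * (a * (w.take j).prod)) ≤ j - i := by
    intro i j hij
    have : w.take j = w.take i ++ (w.drop i).take (j - i) := by
      rw [← List.take_add, Nat.add_sub_cancel' hij]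
    rw [this, List.prod_append, mul_inv_rev, mul_assoc, inv_mul_cancel_left, inv_mul_cancel_left]
    exact (wordLength_le fun x hx => hw x (List.mem_of_mem_drop (List.mem_of_mem_take hx))).trans
      (by simp)
  dsimp only
  rw [← hl]
  refine ⟨fun i => a * (w.take i).prod, h0, h1, fun i j hij hj => ?_⟩
  have e1 := hle 0 i i.zero_le
  have e2 := hle i j hij
  have e3 := hle j _ hj
  have e4 := hd.tri a (a * (w.take i).prod) b
  have e5 := hd.tri (a * (w.take i).prod) (a * (w.take j).prod) b
  rw [h0] at e1
  rw [h1] at e3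
  dsimp only at e4 e5 ⊢
  omega

end WordLength

section Cocycle

/-- Pairs of a group element and a function on the group, with the multiplication that makes
`g ↦ (g, a ↦ f (a * g) - f a)` a homomorphism for every function `f`. -/
@[ext]
structure Cocycle (G : Type*) where
  /-- The underlying group element. -/
  elt : G
  /-- The value of the cocycle along a path starting at a given vertex. -/
  val : G → ℤ

namespace Cocycle

variable {G : Type*} [Group G]

instance : Mul (Cocycle G) :=
  ⟨fun x y => ⟨x.elt * y.elt, fun a => x.val a + y.val (a * x.elt)⟩⟩

instance : One (Cocycle G) := ⟨⟨1, fun _ => 0⟩⟩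

instance : Inv (Cocycle G) := ⟨fun x => ⟨x.elt⁻¹, fun a => -x.val (a * x.elt⁻¹)⟩⟩

@[simp] theorem mul_elt (x y : Cocycle G) : (x * y).elt = x.elt * y.elt := rfl

@[simp] theorem mul_val (x y : Cocycle G) (a : G) :
    (x * y).val a = x.val a + y.val (a * x.elt) := rfl

@[simp] theorem one_elt : (1 : Cocycle G).elt = 1 := rfl

@[simp] theorem one_val (a : G) : (1 : Cocycle G).val a = 0 := rfl

@[simp] theorem inv_elt (x : Cocycle G) : x⁻¹.elt = x.elt⁻¹ := rfl

@[simp] theorem inv_val (x : Cocycle G) (a : G) : x⁻¹.val a = -x.val (a * x.elt⁻¹) := rfl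

instance : Group (Cocycle G) :=
  Group.ofLeftAxioms
    (fun x y z => by ext <;> simp [mul_assoc, add_assoc])
    (fun x => by ext <;> simp)
    (fun x => by ext <;> simp)

/-- The projection to the group. -/
def eltHom : Cocycle G →* G where
  toFun := elt
  map_one' := rfl
  map_mul' _ _ := rfl

theorem conj_val {x c : Cocycle G} (hx : x.elt = 1) (a : G) :
    (c⁻¹ * x * c).val a = x.val (a * c.elt⁻¹) := by
  simp [hx]

/-- If `x i` are cocycles over the identity bounded by `D`, then so is a product of their
conjugates, up to the number of factors. -/
theorem abs_prod_conj_le {D : ℕ} {k : ℕ} (x c : Fin k → Cocycle G) (hx : ∀ i, (x i).elt = 1)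
    (hD : ∀ i a, |(x i).val a| ≤ D) (a : G) :
    |(List.ofFn fun i => (c i)⁻¹ * x i * c i).prod.val a| ≤ D * k := by
  induction k with
  | zero => simp
  | succ k ih =>
    have h1 := ih (fun i => x i.succ) (fun i => c i.succ) (fun i => hx _) fun i => hD _
    have h2 : ((c 0)⁻¹ * x 0 * c 0).elt = 1 := by simp [hx]
    rw [List.ofFn_succ, List.prod_cons, mul_val, h2, mul_one, conj_val (hx 0)]
    refine (abs_add_le _ _).trans ?_
    have h3 := hD 0 (a * (c 0).elt⁻¹)
    push_cast
    linarith

end Cocycle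

end Cocycle

section RelCocycle

variable {G : Type*} [Group G] {Λ : Type*} (H : Λ → Subgroup G) (X₀ : Set G)

theorem exists_wordToF (f : RelFree H X₀) : ∃ w : List (RelLetter H X₀), wordToF w = f := by
  have hmul : ∀ x y : RelFree H X₀, (∃ w : List (RelLetter H X₀), wordToF w = x) →
      (∃ w : List (RelLetter H X₀), wordToF w = y) →
      ∃ w : List (RelLetter H X₀), wordToF w = x * y := by
    rintro _ _ ⟨w, rfl⟩ ⟨v, rfl⟩
    exact ⟨w ++ v, by simp [wordToF]⟩
  induction f using Monoid.Coprod.induction_on with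
  | inl f =>
    induction f using Monoid.CoprodI.induction_on with
    | one => exact ⟨[], by simp [wordToF]⟩
    | of l h =>
      by_cases hh : h = 1
      · exact ⟨[], by simp [wordToF, hh]⟩
      · exact ⟨[Sum.inl ⟨l, h, hh⟩], by simp [wordToF, RelLetter.toF]⟩
    | mul x y hx hy => rw [map_mul]; exact hmul _ _ hx hy
  | inr f =>
    induction f using FreeGroup.induction_on with
    | C1 => exact ⟨[], by simp [wordToF]⟩
    | of x => exact ⟨[Sum.inr (x, true)], by simp [wordToF, RelLetter.toF]⟩
    | inv_of x _ => exact ⟨[Sum.inr (x, false)], by simp [wordToF, RelLetter.toF]⟩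
    | mul x y hx hy => rw [map_mul]; exact hmul _ _ hx hy
  | mul x y hx hy => exact hmul _ _ hx hy

/-- The homomorphism to cocycles that is the coboundary of `χ l` on the `l`-th subgroup and
the cocycle `θ x` on a generator `x`. -/
def cocycleHom (χ : Λ → G → ℤ) (θ : G → G → ℤ) : RelFree H X₀ →* Cocycle G :=
  Monoid.Coprod.lift
    (Monoid.CoprodI.lift fun l =>
      { toFun := fun h => ⟨h, fun a => χ l (a * h) - χ l a⟩
        map_one' := by ext <;> simp
        map_mul' := fun x y => by ext <;> simp [mul_assoc] })
    (FreeGroup.lift fun x => ⟨x, θ x⟩)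

variable {H X₀} (χ : Λ → G → ℤ) (θ : G → G → ℤ)

@[simp] theorem cocycleHom_inl (l : Λ) (h : H l) :
    cocycleHom H X₀ χ θ (Monoid.Coprod.inl (Monoid.CoprodI.of h)) =
      ⟨h, fun a => χ l (a * h) - χ l a⟩ := by
  simp [cocycleHom]

@[simp] theorem cocycleHom_inr (x : X₀) :
    cocycleHom H X₀ χ θ (Monoid.Coprod.inr (FreeGroup.of x)) = ⟨x, θ x⟩ := by
  simp [cocycleHom]

theorem cocycleHom_elt (f : RelFree H X₀) :
    (cocycleHom H X₀ χ θ f).elt = relEps H X₀ f := by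
  have : Cocycle.eltHom.comp (cocycleHom H X₀ χ θ) = relEps H X₀ := by
    ext x
    · simp [relEps, Cocycle.eltHom]
    · simp [relEps, Cocycle.eltHom]
  exact DFunLike.congr_fun this f

/-- Linear isoperimetry bounds cocycles along relative loops. -/
theorem IsIsoperFn.abs_cocycle_le {R : Set (RelFree H X₀)} {F : ℕ → ℕ} (hF : IsIsoperFn H X₀ R F)
    {D : ℕ} (hR : ∀ r ∈ R, relEps H X₀ r = 1)
    (hD : ∀ r ∈ R, ∀ a, |(cocycleHom H X₀ χ θ r).val a| ≤ D)
    {w : List (RelLetter H X₀)} (hw : relEps H X₀ (wordToF w) = 1) (a : G) :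
    |(cocycleHom H X₀ χ θ (wordToF w)).val a| ≤ D * F w.length := by
  obtain ⟨k, hk, r, c, hr, hrc⟩ := hF w hw
  have h := Cocycle.abs_prod_conj_le (D := D) (fun i => cocycleHom H X₀ χ θ (r i))
    (fun i => cocycleHom H X₀ χ θ (c i)) (fun i => by rw [cocycleHom_elt, hR _ (hr i)])
    (fun i => hD _ (hr i)) a
  rw [hrc, map_list_prod, List.map_ofFn]
  simp only [Function.comp_def, map_mul, map_inv]
  exact h.trans (by gcongr)

end RelCocycle

section CosetMin

variable {G : Type*} [Group G] {Λ : Type*} {H : Λ → Subgroup G} {X : Set G}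

/-- The infimum of `β` over the left coset `a K`. -/
noncomputable def cosetMin (K : Subgroup G) (β : G → ℤ) (a : G) : ℤ :=
  sInf {z | ∃ h ∈ K, β (a * h) = z}

theorem cosetMin_mul (K : Subgroup G) (β : G → ℤ) (a : G) {h : G} (hh : h ∈ K) :
    cosetMin K β (a * h) = cosetMin K β a := by
  unfold cosetMin
  congr 1
  ext z
  constructor
  · rintro ⟨k, hk, rfl⟩
    exact ⟨h * k, mul_mem hh hk, by rw [mul_assoc]⟩
  · rintro ⟨k, hk, rfl⟩
    exact ⟨h⁻¹ * k, mul_mem (inv_mem hh) hk, by group⟩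

theorem closure_union_eq_top (hX : Subgroup.closure X = ⊤) :
    Subgroup.closure (X ∪ ⋃ l, (H l : Set G)) = ⊤ :=
  top_le_iff.mp (hX.symm.le.trans (Subgroup.closure_mono Set.subset_union_left))

theorem isPseudoDist_xDist (hX : Subgroup.closure X = ⊤) : IsPseudoDist (xDist X) :=
  isPseudoDist_wordLength hX

theorem isPseudoDist_relDist (hX : Subgroup.closure X = ⊤) : IsPseudoDist (relDist H X) :=
  isPseudoDist_wordLength (closure_union_eq_top hX)

theorem relDist_le_xDist (hX : Subgroup.closure X = ⊤) (a b : G) :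
    relDist H X a b ≤ xDist X a b :=
  wordLength_anti hX Set.subset_union_left _

theorem relDist_le_one {l : Λ} {a b : G} (h : a⁻¹ * b ∈ H l) : relDist H X a b ≤ 1 :=
  wordLength_le_one_of_mem (.inr (Set.mem_iUnion.mpr ⟨l, h⟩))

theorem cosetMin_spec {β : G → ℤ} (hβ : Lip (relDist H X) β) (l : Λ) (a : G) :
    cosetMin (H l) β a ≤ β a ∧ β a ≤ cosetMin (H l) β a + 1 ∧
      ∃ h ∈ H l, β (a * h) = cosetMin (H l) β a := by
  have hb : ∀ h ∈ H l, β a ≤ β (a * h) + 1 := fun h hh => by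
    have h1 := hβ (a * h) a
    have h2 : relDist H X (a * h) a ≤ 1 := relDist_le_one (l := l) (by simpa using hh)
    omega
  have hbdd : BddBelow {z | ∃ h ∈ H l, β (a * h) = z} :=
    ⟨β a - 1, by rintro _ ⟨h, hh, rfl⟩; have := hb h hh; omega⟩
  have hmem : cosetMin (H l) β a ∈ {z | ∃ h ∈ H l, β (a * h) = z} :=
    Int.csInf_mem ⟨β a, 1, one_mem _, by simp⟩ hbdd
  refine ⟨csInf_le hbdd ⟨1, one_mem _, by simp⟩, ?_, hmem⟩
  obtain ⟨h, hh, hz⟩ := hmem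
  rw [← hz]
  exact hb h hh

open Classical in
/-- The local base value of `β` on an edge: the minimum over a coset containing the edge, if any,
and over the endpoints otherwise. -/
noncomputable def baseValue (H : Λ → Subgroup G) (β : G → ℤ) (a b : G) : ℤ :=
  if h : ∃ l, a⁻¹ * b ∈ H l then cosetMin (H h.choose) β a else min (β a) (β b)

theorem baseValue_eq_cosetMin {a b : G} (h : ∃ l, a⁻¹ * b ∈ H l) (β : G → ℤ) :
    ∃ l, a⁻¹ * b ∈ H l ∧ baseValue H β a b = cosetMin (H l) β a :=
  ⟨h.choose, h.choose_spec, by rw [baseValue, dif_pos h]⟩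

theorem isBaseValue_baseValue (hX : Subgroup.closure X = ⊤) {β : G → ℤ}
    (hβ : Lip (relDist H X) β) : IsBaseValue (relDist H X) β (baseValue H β) := by
  have hd := isPseudoDist_relDist (H := H) hX
  intro a b hab
  by_cases h : ∃ l, a⁻¹ * b ∈ H l
  · obtain ⟨l, hl, hm⟩ := baseValue_eq_cosetMin h β
    obtain ⟨h1, -, k, hk, hkβ⟩ := cosetMin_spec hβ l a
    have h2 := (cosetMin_spec hβ l b).1
    rw [show b = a * (a⁻¹ * b) by group, cosetMin_mul _ _ _ hl, ← mul_assoc, mul_inv_cancel,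
      one_mul] at h2
    rw [hm]
    refine ⟨h1, h2, a * k, relDist_le_one (l := l) (by simpa using hk),
      relDist_le_one (l := l) ?_, hkβ⟩
    rw [mul_inv_rev, mul_assoc]
    exact mul_mem (inv_mem hk) hl
  · rw [baseValue, dif_neg h]
    refine ⟨min_le_left _ _, min_le_right _ _, ?_⟩
    rcases le_total (β a) (β b) with h | h
    · exact ⟨a, by rw [hd.self]; omega, hab, (min_eq_left h).symm⟩
    · exact ⟨b, by rwa [hd.symm], by rw [hd.self]; omega, (min_eq_right h).symm⟩

end CosetMin

section Filling

variable {G : Type*} [Group G] {Λ : Type*} {H : Λ → Subgroup G} {X X₀ : Set G}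

/-- The cocycle representing `ρ dβ`: on the `l`-th subgroup it is the coboundary of
`ρ * (β - min β)`, the minimum being taken over cosets. -/
noncomputable def formHom (H : Λ → Subgroup G) (X₀ : Set G) (ρ β : G → ℤ) :
    RelFree H X₀ →* Cocycle G :=
  cocycleHom H X₀ (fun l a => ρ a * (β a - cosetMin (H l) β a))
    fun x a => ρ a * (β (a * x) - β a)

theorem formHom_elt (ρ β : G → ℤ) (f : RelFree H X₀) :
    (formHom H X₀ ρ β f).elt = relEps H X₀ f :=
  cocycleHom_elt _ _ f

theorem Lip.abs_sub_le {V : Type*} {d : V → V → ℕ} (hd : IsPseudoDist d) {f : V → ℤ}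
    (hf : Lip d f) (a b : V) : |f b - f a| ≤ d a b := by
  have h1 := hf a b
  have h2 := hf b a
  rw [hd.symm] at h2
  rw [abs_le]
  omega

theorem relLip_abs_le (hX : Subgroup.closure X = ⊤) {β : G → ℤ} (hβ : Lip (relDist H X) β)
    (a g : G) : |β (a * g) - β a| ≤ wordLength X g := by
  have h1 := hβ.abs_sub_le (isPseudoDist_relDist hX) a (a * g)
  have h2 := relDist_le_xDist (H := H) hX a (a * g)
  rw [xDist, inv_mul_cancel_left] at h2
  exact h1.trans (by exact_mod_cast h2)

theorem xLip_abs_le (hX : Subgroup.closure X = ⊤) {ρ : G → ℤ} (hρ : Lip (xDist X) ρ)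
    (a g : G) : |ρ (a * g) - ρ a| ≤ wordLength X g := by
  have h1 := hρ.abs_sub_le (isPseudoDist_xDist hX) a (a * g)
  rwa [xDist, inv_mul_cancel_left] at h1

/-- For a fixed `f`, the form `ρ dβ` integrates along `f` to `ρ` times the variation of `β`,
up to a bounded error. -/
theorem exists_formHom_approx (hX : Subgroup.closure X = ⊤) (f : RelFree H X₀) :
    ∃ D : ℕ, ∀ ρ β : G → ℤ, Lip (xDist X) ρ → Lip (relDist H X) β → ∀ a,
      |(formHom H X₀ ρ β f).val a - ρ a * (β (a * relEps H X₀ f) - β a)| ≤ D := by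
  have hmul : ∀ x y : RelFree H X₀,
      (∃ D : ℕ, ∀ ρ β : G → ℤ, Lip (xDist X) ρ → Lip (relDist H X) β → ∀ a,
        |(formHom H X₀ ρ β x).val a - ρ a * (β (a * relEps H X₀ x) - β a)| ≤ D) →
      (∃ D : ℕ, ∀ ρ β : G → ℤ, Lip (xDist X) ρ → Lip (relDist H X) β → ∀ a,
        |(formHom H X₀ ρ β y).val a - ρ a * (β (a * relEps H X₀ y) - β a)| ≤ D) →
      ∃ D : ℕ, ∀ ρ β : G → ℤ, Lip (xDist X) ρ → Lip (relDist H X) β → ∀ a,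
        |(formHom H X₀ ρ β (x * y)).val a - ρ a * (β (a * relEps H X₀ (x * y)) - β a)| ≤ D := by
    rintro x y ⟨D, hD⟩ ⟨E, hE⟩
    refine ⟨D + E + wordLength X (relEps H X₀ x) * wordLength X (relEps H X₀ y),
      fun ρ β hρ hβ a => ?_⟩
    have h1 := hD ρ β hρ hβ a
    have h2 := hE ρ β hρ hβ (a * relEps H X₀ x)
    have h3 : |(ρ (a * relEps H X₀ x) - ρ a) *
        (β (a * relEps H X₀ x * relEps H X₀ y) - β (a * relEps H X₀ x))| ≤
        wordLength X (relEps H X₀ x) * wordLength X (relEps H X₀ y) := by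
      rw [abs_mul]
      exact mul_le_mul (xLip_abs_le hX hρ _ _) (relLip_abs_le hX hβ _ _) (abs_nonneg _)
        (by positivity)
    rw [map_mul, map_mul, Cocycle.mul_val, formHom_elt, ← mul_assoc a]
    rw [abs_le] at *
    push_cast
    constructor <;> linarith
  have hone : ∃ D : ℕ, ∀ ρ β : G → ℤ, Lip (xDist X) ρ → Lip (relDist H X) β → ∀ a,
      |(formHom H X₀ ρ β 1).val a - ρ a * (β (a * relEps H X₀ 1) - β a)| ≤ D :=
    ⟨0, fun ρ β _ _ a => by simp⟩
  induction f using Monoid.Coprod.induction_on with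
  | inl f =>
    induction f using Monoid.CoprodI.induction_on with
    | one => simpa only [map_one] using hone
    | of l h =>
      refine ⟨wordLength X (h : G) * 1, fun ρ β hρ hβ a => ?_⟩
      have h1 := xLip_abs_le hX hρ a h
      have h2 := cosetMin_spec hβ l (a * h)
      have h3 : |β (a * h) - cosetMin (H l) β a| ≤ 1 := by
        rw [cosetMin_mul _ _ _ h.2] at h2
        rw [abs_le]
        omega
      simp only [formHom, cocycleHom_inl, cosetMin_mul _ _ _ h.2, relEps,
        Monoid.Coprod.lift_apply_inl, Monoid.CoprodI.lift_of, Subgroup.subtype_apply]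
      have h4 := mul_le_mul h1 h3 (abs_nonneg _) (by positivity)
      rw [← abs_mul] at h4
      push_cast
      refine (le_of_eq (congrArg _ ?_)).trans h4
      ring
    | mul x y hx hy => rw [map_mul]; exact hmul _ _ hx hy
  | inr f =>
    induction f using FreeGroup.induction_on with
    | C1 => simpa only [map_one] using hone
    | of x => exact ⟨0, fun ρ β _ _ a => by simp [formHom, relEps]⟩
    | inv_of x _ =>
      refine ⟨wordLength X (x : G) * wordLength X (x : G), fun ρ β hρ hβ a => ?_⟩
      have h1 := xLip_abs_le hX hρ (a * (x : G)⁻¹) x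
      have h2 := relLip_abs_le hX hβ (a * (x : G)⁻¹) x
      have h4 := mul_le_mul h1 h2 (abs_nonneg _) (by positivity)
      rw [← abs_mul] at h4
      simp only [formHom, map_inv, Cocycle.inv_val, cocycleHom_inr, relEps,
        Monoid.Coprod.lift_apply_inr, FreeGroup.lift_apply_of]
      rw [inv_mul_cancel_right] at *
      push_cast
      refine (le_of_eq (congrArg _ ?_)).trans h4
      ring
    | mul x y hx hy => rw [map_mul]; exact hmul _ _ hx hy
  | mul x y hx hy => exact hmul _ _ hx hy

/-- Along an edge `(a, b)` of the relative Cayley graph the form `ρ dβ` is represented, up to a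
bounded error, by a word of bounded length. -/
theorem exists_word_edgeForm_le (hXfin : X.Finite) (hX : Subgroup.closure X = ⊤)
    (hε : Function.Surjective (relEps H X₀)) :
    ∃ K D : ℕ, ∀ ρ β : G → ℤ, Lip (xDist X) ρ → Lip (relDist H X) β → ∀ a b,
      relDist H X a b ≤ 1 → ∃ w : List (RelLetter H X₀), w.length ≤ K ∧
        relEps H X₀ (wordToF w) = a⁻¹ * b ∧
        edgeForm ρ β (baseValue H β) a b ≤ (formHom H X₀ ρ β (wordToF w)).val a + D := by
  have hw : ∀ g : G, ∃ w : List (RelLetter H X₀), relEps H X₀ (wordToF w) = g := fun g => by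
    obtain ⟨f, rfl⟩ := hε g
    obtain ⟨w, rfl⟩ := exists_wordToF H X₀ f
    exact ⟨w, rfl⟩
  choose w hw using hw
  choose D hD using exists_formHom_approx (H := H) (X₀ := X₀) hX
  have hfin : (X ∪ X⁻¹).Finite := hXfin.union hXfin.inv
  obtain ⟨K, hK⟩ := (hfin.image fun g => (w g).length).bddAbove
  obtain ⟨D₁, hD₁⟩ := (hfin.image fun g => D (wordToF (w g))).bddAbove
  refine ⟨K + 1, D₁ + 1, fun ρ β hρ hβ a b hab => ?_⟩
  by_cases h1 : a⁻¹ * b = 1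
  · obtain rfl := inv_mul_eq_one.mp h1
    refine ⟨[], by simp, by simp [wordToF], ?_⟩
    simp only [edgeForm, wordToF, List.map_nil, List.prod_nil, map_one, Cocycle.one_val, sub_self]
    positivity
  by_cases h : ∃ l, a⁻¹ * b ∈ H l
  · obtain ⟨l, hl, hm⟩ := baseValue_eq_cosetMin h β
    refine ⟨[Sum.inl ⟨l, ⟨a⁻¹ * b, hl⟩, fun hh => h1 (congrArg Subtype.val hh)⟩], by simp,
      by simp [wordToF, RelLetter.toF, relEps], ?_⟩
    simp only [edgeForm, hm, wordToF, List.map_cons, List.map_nil, List.prod_cons, List.prod_nil,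
      mul_one, RelLetter.toF, formHom, cocycleHom_inl]
    rw [cosetMin_mul _ _ _ hl, mul_inv_cancel_left]
    linarith [Int.natCast_nonneg (D₁ + 1)]
  have hmem : a⁻¹ * b ∈ X ∪ X⁻¹ := by
    rcases mem_of_wordLength_le_one (closure_union_eq_top hX) hab with h2 | h2 | h2
    · exact absurd h2 h1
    · exact h2.elim .inl fun h2 => absurd (Set.mem_iUnion.mp h2) h
    · exact h2.elim .inr fun h2 => by
        obtain ⟨l, hl⟩ := Set.mem_iUnion.mp h2
        exact absurd ⟨l, inv_mem_iff.mp hl⟩ h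
  refine ⟨w (a⁻¹ * b), (hK ⟨_, hmem, rfl⟩).trans K.le_succ, hw _, ?_⟩
  have h2 := hD (wordToF (w (a⁻¹ * b))) ρ β hρ hβ a
  have h3 : D (wordToF (w (a⁻¹ * b))) ≤ D₁ := hD₁ ⟨_, hmem, rfl⟩
  rw [hw, mul_inv_cancel_left, abs_le] at h2
  have h4 : |ρ b - ρ a| ≤ 1 := by
    have hX1 : wordLength X (a⁻¹ * b) ≤ 1 := by
      rcases hmem with h | h
      · exact wordLength_le_one_of_mem h
      · rw [← wordLength_inv hX]
        exact wordLength_le_one_of_mem h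
    exact (hρ.abs_sub_le (isPseudoDist_xDist hX) a b).trans (by exact_mod_cast hX1)
  have h5 : |β b - β a| ≤ 1 :=
    (hβ.abs_sub_le (isPseudoDist_relDist hX) a b).trans (by exact_mod_cast hab)
  have h6 : edgeForm ρ β (baseValue H β) a b ≤ ρ a * (β b - β a) + 1 := by
    rw [edgeForm, baseValue, dif_neg h]
    rcases le_total (β a) (β b) with h | h
    · have h7 := mul_le_mul h4 h5 (abs_nonneg _) zero_le_one
      rw [← abs_mul] at h7
      rw [min_eq_left h]
      linarith [(abs_le.mp h7).2]
    · rw [min_eq_right h]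
      linarith
  push_cast
  have h7 : (D (wordToF (w (a⁻¹ * b))) : ℤ) ≤ D₁ := by exact_mod_cast h3
  linarith [h2.1]

/-- A linear relative isoperimetric inequality implies the linear filling inequality for
the relative Cayley graph. -/
theorem exists_linFill (hXfin : X.Finite) (hX : Subgroup.closure X = ⊤) {R : Set (RelFree H X₀)}
    (hP : IsFiniteRelPres H X₀ R) {A B : ℕ} (hF : IsIsoperFn H X₀ R fun n => A * n + B) :
    ∃ C, LinFill (relDist H X) (xDist X) C := by
  obtain ⟨K, D, hKD⟩ := exists_word_edgeForm_le hXfin hX hP.surj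
  choose E hE using exists_formHom_approx (H := H) (X₀ := X₀) hX
  obtain ⟨E₁, hE₁⟩ := (hP.finR.image E).bddAbove
  have hR : ∀ r ∈ R, relEps H X₀ r = 1 := fun r hr =>
    MonoidHom.mem_ker.mp (hP.ker ▸ Subgroup.subset_normalClosure hr)
  refine ⟨E₁ * (A * K + B) + D, fun ρ β hρ hβ =>
    ⟨baseValue H β, isBaseValue_baseValue hX hβ, fun a n S hS => ?_⟩⟩
  have hword : ∀ {b n S}, Reach (relDist H X) (edgeForm ρ β (baseValue H β)) a b n S →
      ∃ w : List (RelLetter H X₀), w.length ≤ K * n ∧ relEps H X₀ (wordToF w) = a⁻¹ * b ∧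
        S ≤ (formHom H X₀ ρ β (wordToF w)).val a + D * n := by
    intro b n S h
    induction h with
    | refl n S hS =>
      refine ⟨[], by simp, by simp [wordToF], hS.trans ?_⟩
      simp only [wordToF, List.map_nil, List.prod_nil, map_one, Cocycle.one_val]
      positivity
    | @step b c n S S' _ hbc hS ih =>
      obtain ⟨w, hw, hwε, hwS⟩ := ih
      obtain ⟨v, hv, hvε, hvS⟩ := hKD ρ β hρ hβ b c hbc
      have happ : wordToF (w ++ v) = wordToF w * wordToF v := by simp [wordToF]
      refine ⟨w ++ v, by rw [List.length_append, mul_add, mul_one]; omega, ?_, ?_⟩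
      · rw [happ, map_mul, hwε, hvε]
        group
      · rw [happ, map_mul, Cocycle.mul_val, formHom_elt, hwε, mul_inv_cancel_left]
        push_cast
        linarith
  rcases Nat.eq_zero_or_pos n with rfl | hn
  · cases hS with
    | refl _ _ hS => simpa using hS
  obtain ⟨w, hw, hwε, hwS⟩ := hword hS
  rw [inv_mul_cancel] at hwε
  have h1 := hF.abs_cocycle_le (D := E₁) (fun l a => ρ a * (β a - cosetMin (H l) β a))
    (fun x a => ρ a * (β (a * x) - β a)) hR (fun r hr a => by
      have h2 := hE r ρ β hρ hβ a
      rw [hR r hr, mul_one, sub_self, mul_zero, sub_zero] at h2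
      exact h2.trans (by exact_mod_cast hE₁ ⟨r, hr, rfl⟩)) hwε a
  have h2 : E₁ * (A * w.length + B) + D * n ≤ (E₁ * (A * K + B) + D) * n :=
    calc E₁ * (A * w.length + B) + D * n ≤ E₁ * (A * (K * n) + B * n) + D * n := by
          gcongr
          exact Nat.le_mul_of_pos_right B hn
      _ = (E₁ * (A * K + B) + D) * n := by ring
  have h3 := (abs_le.mp h1).2
  zify at h2
  push_cast at h3 ⊢
  exact hwS.trans ((add_le_add_left h3 _).trans h2)

theorem IsGeodesic.isGeo {p : RelPath H X} (hp : IsGeodesic p) :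
    IsGeo (relDist H X) p.vertex p.len :=
  fun i j hij hj => (hp i j hij hj).symm

theorem RelPath.vertex_zero (p : RelPath H X) : p.vertex 0 = p.start := by
  simp [RelPath.vertex]

end Filling

end RelHyp

/-- Theorem 3.26. Let `G` be generated by a finite set `X` and hyperbolic
relative to `{H₁,…,H_m}`. There exists `ν > 0` such that for every geodesic triangle `pqr` in
`Γ(G, X ∪ 𝓗)` and every vertex `v` of `p`, there is a vertex `u` on `q ∪ r` with
`dist_X(u, v) ≤ ν`. -/
theorem statement_10 {G : Type*} [Group G] {m : ℕ} (H : Fin m → Subgroup G)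
    (X : Set G) (hXfin : X.Finite) (hXgen : Subgroup.closure X = ⊤)
    (hhyp : IsRelHyperbolic H) :
    ∃ ν : ℝ, 0 < ν ∧
      ∀ p q r : RelPath H X, IsGeodesic p → IsGeodesic q → IsGeodesic r →
        p.finish = q.start → q.finish = r.start → r.finish = p.start →
        ∀ i ≤ p.len, ∃ j : ℕ,
          (j ≤ q.len ∧ (xDist X (q.vertex j) (p.vertex i) : ℝ) ≤ ν) ∨
          (j ≤ r.len ∧ (xDist X (r.vertex j) (p.vertex i) : ℝ) ≤ ν) := by
  obtain ⟨X₀, R, hP, A, B, hF⟩ := hhyp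
  obtain ⟨C, hC⟩ := exists_linFill hXfin hXgen hP hF
  obtain ⟨ν, hν⟩ := hC.slim_strong (isPseudoDist_relDist hXgen) (isPseudoDist_xDist hXgen)
    (relDist_le_xDist hXgen) (hasGeo_wordLength (closure_union_eq_top hXgen))
  refine ⟨ν + 1, by positivity, fun p q r hp hq hr hpq hqr hrp i hi => ?_⟩
  rw [← RelPath.vertex_zero] at hpq hqr hrp
  rcases hν _ _ _ _ _ _ hp.isGeo hq.isGeo hr.isGeo hpq hqr hrp i hi with ⟨j, hj, h⟩ | ⟨j, hj, h⟩
  · exact ⟨j, .inl ⟨hj, by exact_mod_cast h.trans ν.le_succ⟩⟩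
  · exact ⟨j, .inr ⟨hj, by exact_mod_cast h.trans ν.le_succ⟩⟩
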